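/- arXiv:2305.12465 — 2 statements merged into one kernel-verified Lean document; each statement's English description precedes it below -/
import Mathlib

section
/- Let L be a left Hopf algebroid over B. Then the set B^∨(L) of left bisections of L is a group under the convolution product (σ*η)(X) := σ(s(η(X₍₁₎)) X₍₂₎), with unit the counit ε, and the inverse of a left bisection σ is given by σ⁻¹(X) = (σ∘s)⁻¹(ε(X₊ t(σ(X₋)))). -/
open scoped TensorProduct
open TensorProduct

noncomputable section
attribute [local instance] Classical.propDecidable

/-- Choice-based lift of a (bilinear) function to the tensor product: if a linear map agreeing
with `f` on pure tensors exists, this is it (it is then unique); otherwise `0`. -/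
def tlift (R : Type*) [CommRing R] {M N Q : Type*} [AddCommGroup M] [Module R M]
    [AddCommGroup N] [Module R N] [AddCommGroup Q] [Module R Q]
    (f : M → N → Q) : M ⊗[R] N →ₗ[R] Q :=
  if h : ∃ F : M ⊗[R] N →ₗ[R] Q, ∀ x y, F (x ⊗ₜ[R] y) = f x y then h.choose else 0

/-- Choice-based lift of a (bilinear, balanced) function to a quotient of the tensor product. -/
def qtlift (R : Type*) [CommRing R] {M N Q : Type*} [AddCommGroup M] [Module R M]
    [AddCommGroup N] [Module R N] [AddCommGroup Q] [Module R Q]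
    (p : Submodule R (M ⊗[R] N)) (f : M → N → Q) : ((M ⊗[R] N) ⧸ p) →ₗ[R] Q :=
  if h : ∃ F : ((M ⊗[R] N) ⧸ p) →ₗ[R] Q,
      ∀ x y, F (Submodule.Quotient.mk (x ⊗ₜ[R] y)) = f x y then h.choose else 0

variable (k : Type*) [Field k]

/-- Source and target data for a left bialgebroid over `B`: an algebra map `s : B → L` and an
anti-algebra map `t : B → L` with commuting ranges. -/
structure BgdST (B L : Type*) [Ring B] [Algebra k B] [Ring L] [Algebra k L] where
  s : B →ₐ[k] L
  t : B →ₗ[k] L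
  t_one : t 1 = 1
  t_mul : ∀ a b : B, t (a * b) = t b * t a
  st_comm : ∀ a b : B, s a * t b = t b * s a

namespace BgdST

variable {k} {B L : Type*} [Ring B] [Algebra k B] [Ring L] [Algebra k L]
variable (st : BgdST k B L)

/-- The relations defining `L ⊗_B L`: `t a · X ⊗ Y  ~  X ⊗ s a · Y`. -/
def rel : Submodule k (L ⊗[k] L) :=
  Submodule.span k {z | ∃ (a : B) (X Y : L), z = (st.t a * X) ⊗ₜ[k] Y - X ⊗ₜ[k] (st.s a * Y)}

/-- `L ⊗_B L` (the coring tensor square). -/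
abbrev T2 := (L ⊗[k] L) ⧸ st.rel

/-- Class of a pure tensor in `L ⊗_B L`. -/
def mk2 (X Y : L) : st.T2 := Submodule.Quotient.mk (X ⊗ₜ[k] Y)

/-- Evaluate a balanced bilinear expression on an element of `L ⊗_B L`. -/
def lift2 {Q : Type*} [AddCommGroup Q] [Module k Q] (f : L → L → Q) : st.T2 →ₗ[k] Q :=
  qtlift k st.rel f

/-- The relations defining `L ⊗_{B^{op}} L`: `X·t a ⊗ Y ~ X ⊗ t a · Y`. -/
def relOp : Submodule k (L ⊗[k] L) :=
  Submodule.span k {z | ∃ (a : B) (X Y : L), z = (X * st.t a) ⊗ₜ[k] Y - X ⊗ₜ[k] (st.t a * Y)}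

/-- `L ⊗_{B^{op}} L` (domain of the canonical map `λ`). -/
abbrev TOp := (L ⊗[k] L) ⧸ st.relOp

def mkOp (X Y : L) : st.TOp := Submodule.Quotient.mk (X ⊗ₜ[k] Y)

def liftOp {Q : Type*} [AddCommGroup Q] [Module k Q] (f : L → L → Q) : st.TOp →ₗ[k] Q :=
  qtlift k st.relOp f

/-- The relations defining `L ⊗^{B^{op}} L`: `s a · X ⊗ Y ~ X ⊗ Y · s a`. -/
def relA : Submodule k (L ⊗[k] L) :=
  Submodule.span k {z | ∃ (a : B) (X Y : L), z = (st.s a * X) ⊗ₜ[k] Y - X ⊗ₜ[k] (Y * st.s a)}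

/-- `L ⊗^{B^{op}} L` (domain of the canonical map `μ`). -/
abbrev TA := (L ⊗[k] L) ⧸ st.relA

def mkA (X Y : L) : st.TA := Submodule.Quotient.mk (X ⊗ₜ[k] Y)

def liftA {Q : Type*} [AddCommGroup Q] [Module k Q] (f : L → L → Q) : st.TA →ₗ[k] Q :=
  qtlift k st.relA f

/-- Relations for the triple tensor `L ⊗_B L ⊗_B L`. -/
def rel3 : Submodule k (L ⊗[k] (L ⊗[k] L)) :=
  Submodule.span k
    ({z | ∃ (a : B) (X Y Z : L),
        z = (st.t a * X) ⊗ₜ[k] (Y ⊗ₜ[k] Z) - X ⊗ₜ[k] ((st.s a * Y) ⊗ₜ[k] Z)} ∪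
     {z | ∃ (a : B) (X Y Z : L),
        z = X ⊗ₜ[k] ((st.t a * Y) ⊗ₜ[k] Z) - X ⊗ₜ[k] (Y ⊗ₜ[k] (st.s a * Z))})

/-- `L ⊗_B L ⊗_B L`. -/
abbrev T3 := (L ⊗[k] (L ⊗[k] L)) ⧸ st.rel3

def mk3 (X Y Z : L) : st.T3 := Submodule.Quotient.mk (X ⊗ₜ[k] (Y ⊗ₜ[k] Z))

/-- The factorwise product of two elements of `L ⊗_B L`, whenever it is well defined
on representatives (as it is when the left factor lies in the Takeuchi product);
junk value `0` otherwise. -/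
def mulT2 (z w : st.T2) : st.T2 :=
  if h : ∃ u : st.T2, ∀ zr wr : L ⊗[k] L, Submodule.Quotient.mk zr = z →
      Submodule.Quotient.mk wr = w → Submodule.Quotient.mk (zr * wr) = u
  then h.choose else 0

variable (cop : L →ₗ[k] st.T2) (cou : L →ₗ[k] B)

/-- The axioms of a left bialgebroid over `B` with structure `(s,t,Δ,ε) = (st.s, st.t, cop, cou)`
(Definition 2.3 of the paper): `L` is a `B^e`-ring and a `B`-coring, the coproduct corestricts
to an algebra map into the Takeuchi product, and the counit is a left character. -/
structure IsLeftBialgebroid : Prop where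
  comul_one : cop 1 = st.mk2 1 1
  comul_mul : ∀ X Y : L, cop (X * Y) = st.mulT2 (cop X) (cop Y)
  comul_s : ∀ (b : B) (X : L),
    cop (st.s b * X) = st.lift2 (fun x y => st.mk2 (st.s b * x) y) (cop X)
  comul_t : ∀ (b : B) (X : L),
    cop (st.t b * X) = st.lift2 (fun x y => st.mk2 x (st.t b * y)) (cop X)
  takeuchi : ∀ (b : B) (X : L),
    st.lift2 (fun x y => st.mk2 (x * st.t b) y) (cop X) =
      st.lift2 (fun x y => st.mk2 x (y * st.s b)) (cop X)
  coassoc : ∀ X : L,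
    st.lift2 (fun x1 x2 => st.lift2 (fun y1 y2 => st.mk3 x1 y1 y2) (cop x2)) (cop X) =
      st.lift2 (fun x12 x3 => st.lift2 (fun x1 x2 => st.mk3 x1 x2 x3) (cop x12)) (cop X)
  counit_comul_left : ∀ X : L, st.lift2 (fun x1 x2 => st.s (cou x1) * x2) (cop X) = X
  counit_comul_right : ∀ X : L, st.lift2 (fun x1 x2 => st.t (cou x2) * x1) (cop X) = X
  counit_one : cou 1 = 1
  counit_s : ∀ (b : B) (X : L), cou (st.s b * X) = b * cou X
  counit_t : ∀ (b : B) (X : L), cou (st.t b * X) = cou X * b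
  counit_char_s : ∀ X Y : L, cou (X * st.s (cou Y)) = cou (X * Y)
  counit_char_t : ∀ X Y : L, cou (X * st.t (cou Y)) = cou (X * Y)

/-- The canonical map `λ : L ⊗_{B^{op}} L → L ⊗_B L`, `X ⊗ Y ↦ X₍₁₎ ⊗ X₍₂₎Y`. -/
def lam : st.TOp →ₗ[k] st.T2 :=
  st.liftOp (fun X Y => st.lift2 (fun x1 x2 => st.mk2 x1 (x2 * Y)) (cop X))

/-- A left bialgebroid is a left Hopf algebroid if `λ` is bijective. -/
def IsLeftHopf : Prop := Function.Bijective (st.lam cop)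

/-- The canonical map `μ : L ⊗^{B^{op}} L → L ⊗_B L`, `X ⊗ Y ↦ Y₍₁₎X ⊗ Y₍₂₎`. -/
def mu : st.TA →ₗ[k] st.T2 :=
  st.liftA (fun X Y => st.lift2 (fun y1 y2 => st.mk2 (y1 * X) y2) (cop Y))

/-- A left bialgebroid is an anti-left Hopf algebroid if `μ` is bijective. -/
def IsAntiLeftHopf : Prop := Function.Bijective (st.mu cop)

/-- `X₊ ⊗_{B^{op}} X₋ := λ⁻¹(X ⊗_B 1)` (meaningful when `λ` is bijective). -/
def plusMinus (X : L) : st.TOp := Function.invFun (st.lam cop) (st.mk2 X 1)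

/-- `X₍₋₎ ⊗^{B^{op}} X₍₊₎ := μ⁻¹(1 ⊗_B X)` (meaningful when `μ` is bijective). -/
def minusPlus (X : L) : st.TA := Function.invFun (st.mu cop) (st.mk2 1 X)

/-- A left bisection of a left bialgebroid (Definition 3.1). -/
structure IsLeftBisection (σ : L →ₗ[k] B) : Prop where
  unital : σ 1 = 1
  t_prop : ∀ (b : B) (X : L), σ (st.t b * X) = σ X * b
  s_mul : ∀ a b : B, σ (st.s (a * b)) = σ (st.s a) * σ (st.s b)
  s_bij : Function.Bijective (fun b => σ (st.s b))
  prod_t : ∀ X Y : L, σ (X * Y) = σ (X * st.t (σ Y))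
  prod_s : ∀ X Y : L,
    σ (X * Y) = σ (X * st.s (Function.invFun (fun b => σ (st.s b)) (σ Y)))

/-- Convolution of left bisections:  `(σ * η)(X) := σ(s(η(X₍₁₎)) X₍₂₎)`. -/
def bconv (σ η : L →ₗ[k] B) : L →ₗ[k] B :=
  (st.lift2 (fun x1 x2 => σ (st.s (η x1) * x2))).comp cop

/-- A right bisection of a left bialgebroid (Definition 3.6). -/
structure IsRightBisection (σ : L →ₗ[k] B) : Prop where
  unital : σ 1 = 1
  s_prop : ∀ (b : B) (X : L), σ (st.s b * X) = b * σ X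
  t_mul : ∀ a b : B, σ (st.t (a * b)) = σ (st.t b) * σ (st.t a)
  t_bij : Function.Bijective (fun b => σ (st.t b))
  prod_s : ∀ X Y : L, σ (X * Y) = σ (X * st.s (σ Y))
  prod_t : ∀ X Y : L,
    σ (X * Y) = σ (X * st.t (Function.invFun (fun b => σ (st.t b)) (σ Y)))

/-- Convolution of right bisections:  `(σ • η)(X) := σ(t(η(X₍₂₎)) X₍₁₎)`. -/
def rconv (σ η : L →ₗ[k] B) : L →ₗ[k] B :=
  (st.lift2 (fun x1 x2 => σ (st.t (η x2) * x1))).comp cop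

/-- An automorphism `(Φ, φ)` of a left bialgebroid. -/
structure IsBgdAut (Φ : L →ₐ[k] L) (φ : B →ₐ[k] B) : Prop where
  bijL : Function.Bijective Φ
  bijB : Function.Bijective φ
  comp_s : ∀ b : B, Φ (st.s b) = st.s (φ b)
  comp_t : ∀ b : B, Φ (st.t b) = st.t (φ b)
  comp_comul : ∀ X : L,
    cop (Φ X) = st.lift2 (fun x1 x2 => st.mk2 (Φ x1) (Φ x2)) (cop X)
  comp_counit : ∀ X : L, cou (Φ X) = φ (cou X)

/-- `Ad^L_σ(X) := s(σ(X₍₁₎)) X₍₂₎₊ t(σ(X₍₂₎₋))`, for a left Hopf algebroid. -/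
def adL (σ : L →ₗ[k] B) (X : L) : L :=
  st.lift2 (fun x1 x2 => st.s (σ x1) *
    st.liftOp (fun p m => p * st.t (σ m)) (st.plusMinus cop x2)) (cop X)

/-- `Ad^R_σ(X) := t(σ(X₍₂₎)) X₍₁₎₍₊₎ s(σ(X₍₁₎₍₋₎))`, for an anti-left Hopf algebroid. -/
def adR (σ : L →ₗ[k] B) (X : L) : L :=
  st.lift2 (fun x1 x2 => st.t (σ x2) *
    st.liftA (fun m p => p * st.s (σ m)) (st.minusPlus cop x1)) (cop X)

/-- The `B`-bimodule-map conditions on a map `L → B` used for `C¹(L,B)`. -/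
def IsBimodMap (U : L →ₗ[k] B) : Prop :=
  (∀ (b : B) (X : L), U (st.t b * X) = U X * b) ∧
  (∀ (b : B) (X : L), U (st.s b * X) = b * U X)

/-- Convolution `(U * V)(X) = U(X₍₁₎) V(X₍₂₎)` of `B`-valued maps. -/
def cconv (U V : L →ₗ[k] B) : L →ₗ[k] B :=
  (st.lift2 (fun x1 x2 => U x1 * V x2)).comp cop

/-- Extended vertical bisections `C¹(L,B)`: unital convolution-invertible `B`-bimodule maps
`U : L → B` with `U(X s(b)) = U(X t(b))`. -/
def IsC1 (U : L →ₗ[k] B) : Prop :=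
  U 1 = 1 ∧ st.IsBimodMap U ∧
  (∀ (b : B) (X : L), U (X * st.s b) = U (X * st.t b)) ∧
  ∃ V : L →ₗ[k] B, st.IsBimodMap V ∧ st.cconv cop U V = cou ∧ st.cconv cop V U = cou

/-- Convolution product on `B`-bimodule maps `L ⊗_{B^e} L → B`:
`(f ⋆ g)(X,Y) = f(X₍₁₎,Y₍₁₎) g(X₍₂₎,Y₍₂₎)`. -/
def conv2 (f g : L → L → B) (X Y : L) : B :=
  st.lift2 (fun y1 y2 =>
    st.lift2 (fun x1 x2 => f x1 y1 * g x2 y2) (cop X)) (cop Y)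

/-- The unit `ε̃(X ⊗ Y) = ε(XY)` of the convolution algebra. -/
def unit2 (X Y : L) : B := cou (X * Y)

/-- Left-hand side of the 2-cocycle condition: `Γ(X, s(Γ(Y₍₁₎,Z₍₁₎)) Y₍₂₎Z₍₂₎)`. -/
def cocL (Γ : L → L → B) (X Y Z : L) : B :=
  st.lift2 (fun z1 z2 =>
    st.lift2 (fun y1 y2 => Γ X (st.s (Γ y1 z1) * (y2 * z2))) (cop Y)) (cop Z)

/-- Right-hand side of the 2-cocycle condition: `Γ(s(Γ(X₍₁₎,Y₍₁₎)) X₍₂₎Y₍₂₎, Z)`. -/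
def cocR (Γ : L → L → B) (X Y Z : L) : B :=
  st.lift2 (fun y1 y2 =>
    st.lift2 (fun x1 x2 => Γ (st.s (Γ x1 y1) * (x2 * y2)) Z) (cop X)) (cop Y)

/-- Membership of a bilinear map in `_B Hom_B (L ⊗_{B^e} L, B)`. -/
def IsBihom (Γ : L → L → B) : Prop :=
  (∃ Γ' : L →ₗ[k] L →ₗ[k] B, ∀ X Y, Γ' X Y = Γ X Y) ∧
  (∀ (b c : B) (X Y : L), Γ (st.s b * (st.t c * X)) Y = b * Γ X Y * c) ∧
  (∀ (b c : B) (X Y : L), Γ (X * st.s b * st.t c) Y = Γ X (st.s b * (st.t c * Y)))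

/-- An invertible normalised 2-cocycle on a left bialgebroid (Definition 2.6);
the collection of these is `Z²(L,B)`. -/
structure IsZ2 (Γ : L → L → B) : Prop where
  bihom : st.IsBihom Γ
  norm_left : ∀ X : L, Γ 1 X = cou X
  norm_right : ∀ X : L, Γ X 1 = cou X
  st_indep : ∀ (b : B) (X Y : L), Γ X (Y * st.s b) = Γ X (Y * st.t b)
  cocycle : ∀ X Y Z : L, st.cocL cop Γ X Y Z = st.cocR cop Γ X Y Z
  inv : ∃ Γi : L → L → B, st.IsBihom Γi ∧
    (∀ X Y, st.conv2 cop Γ Γi X Y = unit2 cou X Y) ∧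
    (∀ X Y, st.conv2 cop Γi Γ X Y = unit2 cou X Y)

/-- The coboundary `∂U(X,Y) = U⁻¹(X₍₁₎ t(U⁻¹(Y₍₁₎))) U(X₍₂₎Y₍₂₎)` of `U ∈ C¹(L,B)`. -/
def coboundary (U Ui : L →ₗ[k] B) (X Y : L) : B :=
  st.lift2 (fun y1 y2 =>
    st.lift2 (fun x1 x2 => Ui (x1 * st.t (Ui y1)) * U (x2 * y2)) (cop X)) (cop Y)

/-- The transform `Γ^U(X,Y) = U⁻¹(X₍₁₎ t(U⁻¹(Y₍₁₎))) Γ(X₍₂₎,Y₍₂₎) U(X₍₃₎Y₍₃₎)`. -/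
def gammaU (Γ : L → L → B) (U Ui : L →ₗ[k] B) (X Y : L) : B :=
  st.lift2 (fun y1 y23 => st.lift2 (fun y2 y3 =>
    st.lift2 (fun x1 x23 => st.lift2 (fun x2 x3 =>
      Ui (x1 * st.t (Ui y1)) * Γ x2 y2 * U (x3 * y3)) (cop x23)) (cop X))
    (cop y23)) (cop Y)

/-- The cotwisted product `X ·_Γ Y := s(Γ(X₍₁₎,Y₍₁₎)) t(Γ⁻¹(X₍₃₎,Y₍₃₎)) X₍₂₎Y₍₂₎`. -/
def prodG (Γ Γi : L → L → B) (X Y : L) : L :=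
  st.lift2 (fun y1 y23 => st.lift2 (fun y2 y3 =>
    st.lift2 (fun x1 x23 => st.lift2 (fun x2 x3 =>
      st.s (Γ x1 y1) * (st.t (Γi x3 y3) * (x2 * y2))) (cop x23)) (cop X))
    (cop y23)) (cop Y)

/-- `Ad_U(X) := s(U(X₍₁₎)) t(U⁻¹(X₍₃₎)) X₍₂₎`. -/
def adU (U Ui : L →ₗ[k] B) (X : L) : L :=
  st.lift2 (fun x1 x23 => st.lift2 (fun x2 x3 =>
    st.s (U x1) * (st.t (Ui x3) * x2)) (cop x23)) (cop X)

end BgdST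

end

namespace BgdST

variable {k B L : Type*} [Field k] [Ring B] [Algebra k B] [Ring L] [Algebra k L]
  {st : BgdST k B L} {Q : Type*} [AddCommGroup Q] [Module k Q]

section Tensor

theorem mk2_add_left (x x' y : L) : st.mk2 (x + x') y = st.mk2 x y + st.mk2 x' y := by
  simp [mk2, TensorProduct.add_tmul]

theorem mk2_add_right (x y y' : L) : st.mk2 x (y + y') = st.mk2 x y + st.mk2 x y' := by
  simp [mk2, TensorProduct.tmul_add]

theorem mk2_smul_left (c : k) (x y : L) : st.mk2 (c • x) y = c • st.mk2 x y := by
  simp only [mk2, ← TensorProduct.smul_tmul', Submodule.Quotient.mk_smul]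

theorem mk2_smul_right (c : k) (x y : L) : st.mk2 x (c • y) = c • st.mk2 x y := by
  simp [mk2]

theorem mk2_balanced (a : B) (x y : L) : st.mk2 (st.t a * x) y = st.mk2 x (st.s a * y) :=
  (Submodule.Quotient.eq _).2 (Submodule.subset_span ⟨a, x, y, rfl⟩)

theorem mk3_add_left (x x' y z : L) : st.mk3 (x + x') y z = st.mk3 x y z + st.mk3 x' y z := by
  simp [mk3, TensorProduct.add_tmul]

theorem mk3_add_mid (x y y' z : L) : st.mk3 x (y + y') z = st.mk3 x y z + st.mk3 x y' z := by
  simp [mk3, TensorProduct.tmul_add, TensorProduct.add_tmul]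

theorem mk3_add_right (x y z z' : L) : st.mk3 x y (z + z') = st.mk3 x y z + st.mk3 x y z' := by
  simp [mk3, TensorProduct.tmul_add]

theorem mk3_smul_left (c : k) (x y z : L) : st.mk3 (c • x) y z = c • st.mk3 x y z := by
  simp only [mk3, ← TensorProduct.smul_tmul', Submodule.Quotient.mk_smul]

theorem mk3_smul_mid (c : k) (x y z : L) : st.mk3 x (c • y) z = c • st.mk3 x y z := by
  simp only [mk3, ← TensorProduct.smul_tmul', TensorProduct.tmul_smul, Submodule.Quotient.mk_smul]

theorem mk3_smul_right (c : k) (x y z : L) : st.mk3 x y (c • z) = c • st.mk3 x y z := by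
  simp [mk3]

theorem mk3_balanced_left (a : B) (x y z : L) :
    st.mk3 (st.t a * x) y z = st.mk3 x (st.s a * y) z :=
  (Submodule.Quotient.eq _).2 (Submodule.subset_span (Or.inl ⟨a, x, y, z, rfl⟩))

theorem mk3_balanced_right (a : B) (x y z : L) :
    st.mk3 x (st.t a * y) z = st.mk3 x y (st.s a * z) :=
  (Submodule.Quotient.eq _).2 (Submodule.subset_span (Or.inr ⟨a, x, y, z, rfl⟩))

/-- `k`-bilinearity of a function of two variables. -/
structure IsBilin (k : Type*) [Field k] {M N Q : Type*} [AddCommGroup M] [Module k M]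
    [AddCommGroup N] [Module k N] [AddCommGroup Q] [Module k Q] (f : M → N → Q) : Prop where
  add_left : ∀ x x' y, f (x + x') y = f x y + f x' y
  smul_left : ∀ (c : k) x y, f (c • x) y = c • f x y
  add_right : ∀ x y y', f x (y + y') = f x y + f x y'
  smul_right : ∀ (c : k) x y, f x (c • y) = c • f x y

/-- The linear map on the tensor product induced by a bilinear function. -/
noncomputable def IsBilin.lift {f : L → L → Q} (hf : IsBilin k f) : L ⊗[k] L →ₗ[k] Q :=
  TensorProduct.lift (LinearMap.mk₂ k f hf.add_left hf.smul_left hf.add_right hf.smul_right)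

theorem IsBilin.lift_tmul {f : L → L → Q} (hf : IsBilin k f) (x y : L) :
    hf.lift (x ⊗ₜ[k] y) = f x y := by
  simp [IsBilin.lift]

theorem qtlift_mk {p : Submodule k (L ⊗[k] L)} {f : L → L → Q} (hf : IsBilin k f)
    (hp : p ≤ LinearMap.ker hf.lift) (x y : L) :
    qtlift k p f (Submodule.Quotient.mk (x ⊗ₜ[k] y)) = f x y := by
  have h : ∃ F : ((L ⊗[k] L) ⧸ p) →ₗ[k] Q,
      ∀ x y, F (Submodule.Quotient.mk (x ⊗ₜ[k] y)) = f x y :=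
    ⟨p.liftQ hf.lift hp, fun x y => by
      rw [← hf.lift_tmul x y]; exact Submodule.liftQ_apply p hf.lift (x ⊗ₜ[k] y)⟩
  rw [qtlift, dif_pos h]
  exact h.choose_spec x y

theorem lift2_mk {f : L → L → Q} (hf : IsBilin k f)
    (hb : ∀ a x y, f (st.t a * x) y = f x (st.s a * y)) (x y : L) :
    st.lift2 f (st.mk2 x y) = f x y := by
  refine qtlift_mk hf (Submodule.span_le.2 ?_) x y
  rintro _ ⟨a, X, Y, rfl⟩
  simp [hf.lift_tmul, hb]

theorem liftOp_mk {f : L → L → Q} (hf : IsBilin k f)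
    (hb : ∀ a x y, f (x * st.t a) y = f x (st.t a * y)) (x y : L) :
    st.liftOp f (st.mkOp x y) = f x y := by
  refine qtlift_mk hf (Submodule.span_le.2 ?_) x y
  rintro _ ⟨a, X, Y, rfl⟩
  simp [hf.lift_tmul, hb]

theorem lift2_sum {f : L → L → Q} (hf : IsBilin k f)
    (hb : ∀ a x y, f (st.t a * x) y = f x (st.s a * y)) (S : Finset (L × L)) :
    st.lift2 f (∑ p ∈ S, st.mk2 p.1 p.2) = ∑ p ∈ S, f p.1 p.2 := by
  simp [map_sum, lift2_mk hf hb]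

theorem exists_sum_mk2 (z : st.T2) : ∃ S : Finset (L × L), z = ∑ p ∈ S, st.mk2 p.1 p.2 := by
  obtain ⟨w, rfl⟩ := Submodule.Quotient.mk_surjective _ z
  obtain ⟨S, rfl⟩ := TensorProduct.exists_finset w
  exact ⟨S, map_sum st.rel.mkQ _ _⟩

theorem exists_sum_mkOp (z : st.TOp) : ∃ S : Finset (L × L), z = ∑ p ∈ S, st.mkOp p.1 p.2 := by
  obtain ⟨w, rfl⟩ := Submodule.Quotient.mk_surjective _ z
  obtain ⟨S, rfl⟩ := TensorProduct.exists_finset w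
  exact ⟨S, map_sum st.relOp.mkQ _ _⟩

theorem t_mul_s (st : BgdST k B L) (a b : B) (x : L) :
    st.t a * (st.s b * x) = st.s b * (st.t a * x) := by
  rw [← mul_assoc, ← mul_assoc, st.st_comm]

/-- Right multiplication of `L ⊗_B L` by `u ⊗ v`. -/
noncomputable def mulRight (st : BgdST k B L) (u v : L) : st.T2 →ₗ[k] st.T2 :=
  st.lift2 (fun x y => st.mk2 (x * u) (y * v))

theorem mulRight_mk2 (u v x y : L) :
    st.mulRight u v (st.mk2 x y) = st.mk2 (x * u) (y * v) := by
  refine lift2_mk ⟨?_, ?_, ?_, ?_⟩ ?_ x y <;> intros <;>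
    simp [add_mul, mk2_add_left, mk2_add_right, mk2_smul_left, mk2_smul_right, mul_assoc,
      mk2_balanced]

theorem mul_mem_rel {z : L ⊗[k] L} (hz : z ∈ st.rel) (w : L ⊗[k] L) : z * w ∈ st.rel := by
  induction hz using Submodule.span_induction with
  | mem z h =>
    obtain ⟨a, X, Y, rfl⟩ := h
    induction w using TensorProduct.induction_on with
    | zero => simp
    | tmul u v =>
      refine Submodule.subset_span ⟨a, X * u, Y * v, ?_⟩
      simp [sub_mul, mul_assoc]
    | add w w' h h' => rw [mul_add]; exact add_mem h h'
  | zero => simp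
  | add z z' _ _ h h' => rw [add_mul]; exact add_mem h h'
  | smul c z _ h => rw [smul_mul_assoc]; exact st.rel.smul_mem c h

end Tensor

section Bialgebroid

variable {cop : L →ₗ[k] st.T2} {cou : L →ₗ[k] B}

theorem IsLeftBialgebroid.takeuchi_sum (hb : st.IsLeftBialgebroid cop cou) {X : L}
    {S : Finset (L × L)} (hS : cop X = ∑ p ∈ S, st.mk2 p.1 p.2) (b : B) :
    ∑ p ∈ S, st.mk2 (p.1 * st.t b) p.2 = ∑ p ∈ S, st.mk2 p.1 (p.2 * st.s b) := by
  have h : st.mulRight (st.t b) 1 (cop X) = st.mulRight 1 (st.s b) (cop X) := by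
    simpa only [mulRight, mul_one] using hb.takeuchi b X
  simpa only [hS, map_sum, mulRight_mk2, mul_one] using h

/-- Left multiplication of `L ⊗_B L` by `∑ p ∈ S, p.1 ⊗ p.2`. It is well defined when this sum
represents a coproduct. -/
noncomputable def mulLeft (st : BgdST k B L) (S : Finset (L × L)) : st.T2 →ₗ[k] st.T2 :=
  st.lift2 (fun u v => ∑ p ∈ S, st.mk2 (p.1 * u) (p.2 * v))

theorem IsLeftBialgebroid.mulLeft_mk2 (hb : st.IsLeftBialgebroid cop cou) {X : L}
    {S : Finset (L × L)} (hS : cop X = ∑ p ∈ S, st.mk2 p.1 p.2) (u v : L) :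
    st.mulLeft S (st.mk2 u v) = ∑ p ∈ S, st.mk2 (p.1 * u) (p.2 * v) := by
  refine lift2_mk ⟨?_, ?_, ?_, ?_⟩ ?_ u v
  case refine_5 =>
    intro a x y
    have h := congrArg (st.mulRight x y) (hb.takeuchi_sum hS a)
    simpa only [map_sum, mulRight_mk2, mul_assoc] using h
  all_goals intros; simp [mul_add, mk2_add_left, mk2_add_right, mk2_smul_left, mk2_smul_right,
    Finset.sum_add_distrib, Finset.smul_sum]

theorem IsLeftBialgebroid.comul_mul_eq (hb : st.IsLeftBialgebroid cop cou) {X : L}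
    {S : Finset (L × L)} (hS : cop X = ∑ p ∈ S, st.mk2 p.1 p.2) (Y : L) :
    cop (X * Y) = st.mulLeft S (cop Y) := by
  have key (zr wr : L ⊗[k] L) (hz : Submodule.Quotient.mk zr = cop X)
      (hw : Submodule.Quotient.mk wr = cop Y) : (Submodule.Quotient.mk (zr * wr) : st.T2) =
        st.mulLeft S (cop Y) := by
    have hd : zr - ∑ p ∈ S, p.1 ⊗ₜ[k] p.2 ∈ st.rel := by
      rw [← Submodule.Quotient.eq, hz, hS]
      exact (map_sum st.rel.mkQ _ _).symm
    have h1 : (Submodule.Quotient.mk (zr * wr) : st.T2) =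
        Submodule.Quotient.mk ((∑ p ∈ S, p.1 ⊗ₜ[k] p.2) * wr) := by
      rw [Submodule.Quotient.eq, ← sub_mul]
      exact mul_mem_rel hd wr
    rw [h1, ← hw]
    clear h1 hw
    induction wr using TensorProduct.induction_on with
    | zero => simp
    | tmul u v =>
      refine Eq.trans ?_ (hb.mulLeft_mk2 hS u v).symm
      rw [Finset.sum_mul]
      simp only [Algebra.TensorProduct.tmul_mul_tmul]
      exact map_sum st.rel.mkQ (fun p => (p.1 * u) ⊗ₜ[k] (p.2 * v)) S
    | add w w' h h' => rw [mul_add, Submodule.Quotient.mk_add, h, h', ← map_add]; rfl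
  obtain ⟨zr, hz⟩ := Submodule.Quotient.mk_surjective _ (cop X)
  obtain ⟨wr, hw⟩ := Submodule.Quotient.mk_surjective _ (cop Y)
  have h : ∃ u : st.T2, ∀ zr wr : L ⊗[k] L, Submodule.Quotient.mk zr = cop X →
      Submodule.Quotient.mk wr = cop Y → Submodule.Quotient.mk (zr * wr) = u := ⟨_, key⟩
  rw [hb.comul_mul, mulT2, dif_pos h, ← h.choose_spec zr wr hz hw, key zr wr hz hw]

theorem IsLeftBialgebroid.comul_mul_sum (hb : st.IsLeftBialgebroid cop cou) {X Y : L}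
    {S T : Finset (L × L)} (hS : cop X = ∑ p ∈ S, st.mk2 p.1 p.2)
    (hT : cop Y = ∑ q ∈ T, st.mk2 q.1 q.2) :
    cop (X * Y) = ∑ q ∈ T, ∑ p ∈ S, st.mk2 (p.1 * q.1) (p.2 * q.2) := by
  rw [hb.comul_mul_eq hS, hT, map_sum]
  exact Finset.sum_congr rfl fun q _ => hb.mulLeft_mk2 hS q.1 q.2

theorem IsLeftBialgebroid.comul_s_mul_sum (hb : st.IsLeftBialgebroid cop cou) {X : L}
    {S : Finset (L × L)} (hS : cop X = ∑ p ∈ S, st.mk2 p.1 p.2) (b : B) :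
    cop (st.s b * X) = ∑ p ∈ S, st.mk2 (st.s b * p.1) p.2 := by
  rw [hb.comul_s, hS]
  refine lift2_sum ⟨?_, ?_, ?_, ?_⟩ ?_ S <;> intros <;>
    simp [mul_add, mk2_add_left, mk2_add_right, mk2_smul_left, mk2_smul_right, ← t_mul_s,
      mk2_balanced]

theorem IsLeftBialgebroid.comul_t_mul_sum (hb : st.IsLeftBialgebroid cop cou) {X : L}
    {S : Finset (L × L)} (hS : cop X = ∑ p ∈ S, st.mk2 p.1 p.2) (b : B) :
    cop (st.t b * X) = ∑ p ∈ S, st.mk2 p.1 (st.t b * p.2) := by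
  rw [hb.comul_t, hS]
  refine lift2_sum ⟨?_, ?_, ?_, ?_⟩ ?_ S <;> intros <;>
    simp [mul_add, mk2_add_left, mk2_add_right, mk2_smul_left, mk2_smul_right, t_mul_s,
      mk2_balanced]

theorem IsLeftBialgebroid.comul_s_eq (hb : st.IsLeftBialgebroid cop cou) (b : B) :
    cop (st.s b) = st.mk2 (st.s b) 1 := by
  have h := hb.comul_s_mul_sum (X := 1) (S := {(1, 1)}) (by simpa using hb.comul_one) b
  simpa using h

theorem IsLeftBialgebroid.comul_t_eq (hb : st.IsLeftBialgebroid cop cou) (b : B) :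
    cop (st.t b) = st.mk2 1 (st.t b) := by
  have h := hb.comul_t_mul_sum (X := 1) (S := {(1, 1)}) (by simpa using hb.comul_one) b
  simpa using h

theorem IsLeftBialgebroid.comul_mul_s_sum (hb : st.IsLeftBialgebroid cop cou) {X : L}
    {S : Finset (L × L)} (hS : cop X = ∑ p ∈ S, st.mk2 p.1 p.2) (b : B) :
    cop (X * st.s b) = ∑ p ∈ S, st.mk2 (p.1 * st.s b) p.2 := by
  have h := hb.comul_mul_sum (Y := st.s b) (T := {(st.s b, 1)}) hS (by simpa using hb.comul_s_eq b)
  simpa using h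

theorem IsLeftBialgebroid.comul_mul_t_sum (hb : st.IsLeftBialgebroid cop cou) {X : L}
    {S : Finset (L × L)} (hS : cop X = ∑ p ∈ S, st.mk2 p.1 p.2) (b : B) :
    cop (X * st.t b) = ∑ p ∈ S, st.mk2 p.1 (p.2 * st.t b) := by
  have h := hb.comul_mul_sum (Y := st.t b) (T := {(1, st.t b)}) hS (by simpa using hb.comul_t_eq b)
  simpa using h

theorem IsLeftBialgebroid.counit_s_eq (hb : st.IsLeftBialgebroid cop cou) (b : B) :
    cou (st.s b) = b := by
  simpa [hb.counit_one] using hb.counit_s b 1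

theorem IsLeftBialgebroid.counit_t_eq (hb : st.IsLeftBialgebroid cop cou) (b : B) :
    cou (st.t b) = b := by
  simpa [hb.counit_one] using hb.counit_t b 1

theorem IsLeftBialgebroid.counit_mul_t (hb : st.IsLeftBialgebroid cop cou) (X : L) (b : B) :
    cou (X * st.t b) = cou (X * st.s b) := by
  rw [← hb.counit_char_s X (st.t b), hb.counit_t_eq]

end Bialgebroid

section Bisection

variable {cop : L →ₗ[k] st.T2} {cou : L →ₗ[k] B} {σ η ρ : L →ₗ[k] B}

theorem IsLeftBisection.apply_t (hσ : st.IsLeftBisection σ) (b : B) : σ (st.t b) = b := by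
  simpa [hσ.unital] using hσ.t_prop b 1

theorem IsLeftBisection.prod_s' (hσ : st.IsLeftBisection σ) (X : L) {Y : L} {b : B}
    (h : σ (st.s b) = σ Y) : σ (X * st.s b) = σ (X * Y) := by
  rw [hσ.prod_s X Y, ← h]
  exact congrArg (fun c => σ (X * st.s c)) (Function.leftInverse_invFun hσ.s_bij.1 b).symm

theorem IsLeftBisection.mul_s (hσ : st.IsLeftBisection σ) (X : L) (b : B) :
    σ (X * st.s b) = σ (X * st.t (σ (st.s b))) :=
  hσ.prod_s' X (hσ.apply_t _).symm

theorem IsLeftBisection.s_mul_left (hσ : st.IsLeftBisection σ) (b : B) (X : L) :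
    σ (st.s b * X) = σ (st.s b) * σ X := by
  rw [hσ.prod_t, st.st_comm, hσ.t_prop]

theorem IsLeftBisection.apply_s_invFun (hσ : st.IsLeftBisection σ) (b : B) :
    σ (st.s (Function.invFun (fun b => σ (st.s b)) b)) = b :=
  Function.invFun_eq (hσ.s_bij.2 b)

theorem isLeftBisection_of_prod_s (h1 : σ 1 = 1) (ht : ∀ (b : B) (X : L), σ (st.t b * X) = σ X * b)
    (hm : ∀ a b : B, σ (st.s (a * b)) = σ (st.s a) * σ (st.s b))
    (hbij : Function.Bijective (fun b => σ (st.s b)))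
    (hpt : ∀ X Y : L, σ (X * Y) = σ (X * st.t (σ Y)))
    (hps : ∀ (X Y : L) (b : B), σ (st.s b) = σ Y → σ (X * Y) = σ (X * st.s b)) :
    st.IsLeftBisection σ :=
  ⟨h1, ht, hm, hbij, hpt, fun X Y => hps X Y _ (Function.invFun_eq (hbij.2 (σ Y)))⟩

theorem IsLeftBisection.lift2_bconv_mk (hη : st.IsLeftBisection η) (σ : L →ₗ[k] B) (x y : L) :
    st.lift2 (fun x y => σ (st.s (η x) * y)) (st.mk2 x y) = σ (st.s (η x) * y) := by
  refine lift2_mk ⟨?_, ?_, ?_, ?_⟩ ?_ x y <;> intros <;>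
    simp [mul_add, add_mul, hη.t_prop, mul_assoc]

theorem IsLeftBisection.bconv_eq_sum (hη : st.IsLeftBisection η) (σ : L →ₗ[k] B) {X : L}
    {S : Finset (L × L)} (hS : cop X = ∑ p ∈ S, st.mk2 p.1 p.2) :
    st.bconv cop σ η X = ∑ p ∈ S, σ (st.s (η p.1) * p.2) := by
  simp only [bconv, LinearMap.comp_apply, hS, map_sum, hη.lift2_bconv_mk]

theorem IsLeftBisection.bconv_s (hb : st.IsLeftBialgebroid cop cou) (σ : L →ₗ[k] B)
    (hη : st.IsLeftBisection η) (b : B) :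
    st.bconv cop σ η (st.s b) = σ (st.s (η (st.s b))) := by
  have h := hη.bconv_eq_sum σ (X := st.s b) (S := {(st.s b, 1)}) (by simpa using hb.comul_s_eq b)
  simpa using h

theorem IsLeftBisection.bconv (hb : st.IsLeftBialgebroid cop cou) (hσ : st.IsLeftBisection σ)
    (hη : st.IsLeftBisection η) : st.IsLeftBisection (st.bconv cop σ η) := by
  have hs := hη.bconv_s hb σ
  have hswap {X : L} {S : Finset (L × L)} (hS : cop X = ∑ p ∈ S, st.mk2 p.1 p.2) (d : B) (Z : L) :
      ∑ p ∈ S, σ (st.s (η (p.1 * st.t d)) * (p.2 * Z)) =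
        ∑ p ∈ S, σ (st.s (η p.1) * (p.2 * (st.s d * Z))) := by
    have h (x y : L) : st.lift2 (fun x y => σ (st.s (η x) * (y * Z))) (st.mk2 x y) =
        σ (st.s (η x) * (y * Z)) := by
      refine lift2_mk ⟨?_, ?_, ?_, ?_⟩ ?_ x y <;> intros <;>
        simp [mul_add, add_mul, hη.t_prop, mul_assoc]
    have h' := congrArg (st.lift2 (fun x y => σ (st.s (η x) * (y * Z)))) (hb.takeuchi_sum hS d)
    simpa only [map_sum, h, mul_assoc] using h'
  have hmt {X : L} {S : Finset (L × L)} (hS : cop X = ∑ p ∈ S, st.mk2 p.1 p.2) (c : B) :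
      st.bconv cop σ η (X * st.t c) = ∑ p ∈ S, σ (st.s (η p.1) * (p.2 * st.t c)) := by
    simp only [BgdST.bconv, LinearMap.comp_apply, hb.comul_mul_t_sum hS, map_sum,
      hη.lift2_bconv_mk]
  have hpt (X Y : L) : st.bconv cop σ η (X * Y) =
      st.bconv cop σ η (X * st.t (st.bconv cop σ η Y)) := by
    obtain ⟨S, hS⟩ := exists_sum_mk2 (cop X)
    obtain ⟨T, hT⟩ := exists_sum_mk2 (cop Y)
    rw [hmt hS, hη.bconv_eq_sum σ hT, BgdST.bconv, LinearMap.comp_apply, hb.comul_mul_sum hS hT]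
    simp only [map_sum, hη.lift2_bconv_mk, Finset.mul_sum]
    conv_rhs => rw [Finset.sum_comm]
    refine Finset.sum_congr rfl fun q _ => ?_
    have h (p : L × L) : σ (st.s (η (p.1 * q.1)) * (p.2 * q.2)) =
        σ (st.s (η (p.1 * st.t (η q.1))) * (p.2 * q.2)) := by rw [hη.prod_t]
    simp only [h, hswap hS]
    refine Finset.sum_congr rfl fun p _ => ?_
    rw [← mul_assoc, hσ.prod_t, mul_assoc]
  refine isLeftBisection_of_prod_s ?_ ?_ ?_ ?_ hpt ?_
  · simpa [hη.unital, hσ.unital] using hs 1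
  · intro b X
    obtain ⟨S, hS⟩ := exists_sum_mk2 (cop X)
    rw [hη.bconv_eq_sum σ hS, BgdST.bconv, LinearMap.comp_apply, hb.comul_t_mul_sum hS]
    simp only [map_sum, hη.lift2_bconv_mk, Finset.sum_mul, ← t_mul_s, hσ.t_prop]
  · intro a b
    simp only [hs, hη.s_mul, hσ.s_mul]
  · simpa only [hs, Function.comp_def] using hσ.s_bij.comp hη.s_bij
  · intro X Y b h
    obtain ⟨S, hS⟩ := exists_sum_mk2 (cop X)
    rw [hpt, ← h, hs, hmt hS, BgdST.bconv, LinearMap.comp_apply, hb.comul_mul_s_sum hS]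
    have h1 := hswap hS (η (st.s b)) 1
    simp only [map_sum, hη.lift2_bconv_mk, hη.mul_s]
    simp only [mul_one] at h1
    rw [h1]
    refine Finset.sum_congr rfl fun p _ => ?_
    rw [← mul_assoc, ← mul_assoc, hσ.mul_s]

theorem IsLeftBialgebroid.isLeftBisection_counit (hb : st.IsLeftBialgebroid cop cou) :
    st.IsLeftBisection cou := by
  refine isLeftBisection_of_prod_s hb.counit_one hb.counit_t ?_ ?_
    (fun X Y => (hb.counit_char_t X Y).symm) ?_
  · simp only [hb.counit_s_eq, implies_true]
  · simp only [hb.counit_s_eq]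
    exact Function.bijective_id
  · intro X Y b h
    rw [hb.counit_s_eq] at h
    rw [h, hb.counit_char_s]

/-- The map `y ⊗ z ↦ x ⊗ y ⊗ z`. -/
noncomputable def mk3Left (st : BgdST k B L) (x : L) : st.T2 →ₗ[k] st.T3 :=
  st.lift2 (fun y z => st.mk3 x y z)

theorem mk3Left_mk2 (x y z : L) : st.mk3Left x (st.mk2 y z) = st.mk3 x y z := by
  refine lift2_mk ⟨?_, ?_, ?_, ?_⟩ ?_ y z <;> intros <;>
    simp [mk3_add_mid, mk3_add_right, mk3_smul_mid, mk3_smul_right, mk3_balanced_right]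

/-- The map `x ⊗ y ↦ x ⊗ y ⊗ z`. -/
noncomputable def mk3Right (st : BgdST k B L) (z : L) : st.T2 →ₗ[k] st.T3 :=
  st.lift2 (fun x y => st.mk3 x y z)

theorem mk3Right_mk2 (x y z : L) : st.mk3Right z (st.mk2 x y) = st.mk3 x y z := by
  refine lift2_mk ⟨?_, ?_, ?_, ?_⟩ ?_ x y <;> intros <;>
    simp [mk3_add_left, mk3_add_mid, mk3_smul_left, mk3_smul_mid, mk3_balanced_left]

theorem IsLeftBialgebroid.coassoc_sum (hb : st.IsLeftBialgebroid cop cou) {X : L}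
    {S : Finset (L × L)} (hS : cop X = ∑ p ∈ S, st.mk2 p.1 p.2) {U : L → Finset (L × L)}
    (hU : ∀ x, cop x = ∑ p ∈ U x, st.mk2 p.1 p.2) :
    ∑ p ∈ S, ∑ q ∈ U p.2, st.mk3 p.1 q.1 q.2 = ∑ p ∈ S, ∑ q ∈ U p.1, st.mk3 q.1 q.2 p.2 := by
  have hr' (x w : L) : st.lift2 (fun x w => st.mk3Left x (cop w))
      (st.mk2 x w) = ∑ q ∈ U w, st.mk3 x q.1 q.2 := by
    rw [lift2_mk ⟨?_, ?_, ?_, ?_⟩ ?_]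
    · simp only [hU w, map_sum, mk3Left_mk2]
    · intro x x' w
      simp only [hU w, map_sum, mk3Left_mk2, mk3_add_left, Finset.sum_add_distrib]
    · intro c x w
      simp only [hU w, map_sum, mk3Left_mk2, mk3_smul_left, Finset.smul_sum]
    · simp
    · simp
    · intro a x w
      simp only [hb.comul_s_mul_sum (hU w) a, hU w, map_sum, mk3Left_mk2, mk3_balanced_left]
  have hl' (w z : L) : st.lift2 (fun w z => st.mk3Right z (cop w))
      (st.mk2 w z) = ∑ q ∈ U w, st.mk3 q.1 q.2 z := by
    rw [lift2_mk ⟨?_, ?_, ?_, ?_⟩ ?_]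
    · simp only [hU w, map_sum, mk3Right_mk2]
    · simp
    · simp
    · intro w z z'
      simp only [hU w, map_sum, mk3Right_mk2, mk3_add_right, Finset.sum_add_distrib]
    · intro c w z
      simp only [hU w, map_sum, mk3Right_mk2, mk3_smul_right, Finset.smul_sum]
    · intro a w z
      simp only [hb.comul_t_mul_sum (hU w) a, hU w, map_sum, mk3Right_mk2, mk3_balanced_right]
  have h : st.lift2 (fun x w => st.mk3Left x (cop w)) (cop X) =
      st.lift2 (fun w z => st.mk3Right z (cop w)) (cop X) := hb.coassoc X
  simpa only [hS, map_sum, hr', hl'] using h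

theorem IsLeftBisection.bconv_assoc (hb : st.IsLeftBialgebroid cop cou)
    (hη : st.IsLeftBisection η) (hρ : st.IsLeftBisection ρ) (σ : L →ₗ[k] B)
    (hηρ : st.IsLeftBisection (st.bconv cop η ρ)) :
    st.bconv cop (st.bconv cop σ η) ρ = st.bconv cop σ (st.bconv cop η ρ) := by
  have h₁ : IsBilin k fun x y => st.s (η (st.s (ρ x) * y)) := by
    constructor <;> intros <;> simp [add_mul, mul_add]
  have h₂ : IsBilin k fun x y => σ (x * y) := by
    constructor <;> intros <;> simp [add_mul, mul_add]
  let F₀ : L ⊗[k] (L ⊗[k] L) →ₗ[k] B :=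
    h₂.lift ∘ₗ TensorProduct.map h₁.lift LinearMap.id ∘ₗ (TensorProduct.assoc k L L L).symm
  have hF₀ (x y z : L) : F₀ (x ⊗ₜ (y ⊗ₜ z)) = σ (st.s (η (st.s (ρ x) * y)) * z) := by
    simp [F₀, IsBilin.lift_tmul]
  have hker : st.rel3 ≤ LinearMap.ker F₀ := by
    refine Submodule.span_le.2 ?_
    rintro _ (⟨a, X, Y, Z, rfl⟩ | ⟨a, X, Y, Z, rfl⟩)
    · simp [hF₀, hρ.t_prop, mul_assoc]
    · simp [hF₀, ← t_mul_s, hη.t_prop, mul_assoc]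
  have hF (x y z : L) : st.rel3.liftQ F₀ hker (st.mk3 x y z) =
      σ (st.s (η (st.s (ρ x) * y)) * z) := hF₀ x y z
  ext X
  obtain ⟨S, hS⟩ := exists_sum_mk2 (cop X)
  choose U hU using fun x => exists_sum_mk2 (cop x)
  have h := congrArg (st.rel3.liftQ F₀ hker) (hb.coassoc_sum hS hU)
  simp only [map_sum, hF] at h
  rw [hρ.bconv_eq_sum _ hS, hηρ.bconv_eq_sum σ hS]
  refine Eq.trans ?_ (h.trans ?_)
  · refine Finset.sum_congr rfl fun p _ => ?_
    simp only [BgdST.bconv, LinearMap.comp_apply, hb.comul_s_mul_sum (hU p.2), map_sum,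
      hη.lift2_bconv_mk]
  · refine Finset.sum_congr rfl fun p _ => ?_
    rw [hρ.bconv_eq_sum η (hU p.1)]
    simp only [map_sum, Finset.sum_mul]

theorem IsLeftBisection.bconv_counit (hb : st.IsLeftBialgebroid cop cou) (σ : L →ₗ[k] B) :
    st.bconv cop σ cou = σ := by
  ext X
  obtain ⟨S, hS⟩ := exists_sum_mk2 (cop X)
  rw [hb.isLeftBisection_counit.bconv_eq_sum σ hS, ← map_sum]
  congr 1
  have h := hb.counit_comul_left X
  rw [hS, lift2_sum] at h
  · exact h
  · constructor <;> intros <;> simp [mul_add, add_mul]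
  · intros; simp [hb.counit_t, mul_assoc]

theorem IsLeftBisection.counit_bconv (hb : st.IsLeftBialgebroid cop cou)
    (hσ : st.IsLeftBisection σ) : st.bconv cop cou σ = σ := by
  ext X
  obtain ⟨S, hS⟩ := exists_sum_mk2 (cop X)
  rw [hσ.bconv_eq_sum cou hS]
  have h := hb.counit_comul_right X
  rw [hS, lift2_sum] at h
  · rw [← h, map_sum]
    simp only [hb.counit_s, hσ.t_prop]
  · constructor <;> intros <;> simp [mul_add, add_mul]
  · intros; simp [hb.counit_s, st.t_mul, mul_assoc]

end Bisection

section Hopf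

variable {cop : L →ₗ[k] st.T2} {cou : L →ₗ[k] B} {σ : L →ₗ[k] B}

theorem IsLeftBialgebroid.lam_mkOp (hb : st.IsLeftBialgebroid cop cou) (X Y : L) :
    st.lam cop (st.mkOp X Y) = st.mulRight 1 Y (cop X) := by
  have h : st.lam cop = st.liftOp (fun X Y => st.mulRight 1 Y (cop X)) := by
    simp only [mulRight, mul_one]
    rfl
  rw [h, liftOp_mk ⟨?_, ?_, ?_, ?_⟩ ?_]
  · simp
  · simp
  · intro x Z Z'
    obtain ⟨T, hT⟩ := exists_sum_mk2 (cop x)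
    simp only [hT, map_sum, mulRight_mk2, mul_add, mk2_add_right, Finset.sum_add_distrib]
  · intro c x Z
    obtain ⟨T, hT⟩ := exists_sum_mk2 (cop x)
    simp only [hT, map_sum, mulRight_mk2, mul_smul_comm, mk2_smul_right, Finset.smul_sum]
  · intro a x Z
    obtain ⟨T, hT⟩ := exists_sum_mk2 (cop x)
    simp only [hb.comul_mul_t_sum hT, hT, map_sum, mulRight_mk2, mul_assoc]

theorem IsLeftBialgebroid.lam_mkOp_mul_right (hb : st.IsLeftBialgebroid cop cou) (X Y Z : L) :
    st.lam cop (st.mkOp X (Y * Z)) =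
      st.mulRight 1 Z (st.lam cop (st.mkOp X Y)) := by
  obtain ⟨S, hS⟩ := exists_sum_mk2 (cop X)
  simp only [hb.lam_mkOp, hS, map_sum, mulRight_mk2, mul_assoc, mul_one]

/-- Left multiplication of `L ⊗_B L` by `1 ⊗ t b`. -/
noncomputable def tMul (st : BgdST k B L) (b : B) : st.T2 →ₗ[k] st.T2 :=
  st.lift2 (fun x y => st.mk2 x (st.t b * y))

theorem tMul_mk2 (b : B) (x y : L) : st.tMul b (st.mk2 x y) = st.mk2 x (st.t b * y) := by
  refine lift2_mk ⟨?_, ?_, ?_, ?_⟩ ?_ x y <;> intros <;>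
    simp [mul_add, mk2_add_left, mk2_add_right, mk2_smul_left, mk2_smul_right, t_mul_s,
      mk2_balanced]

theorem IsLeftBialgebroid.lam_mkOp_t_mul (hb : st.IsLeftBialgebroid cop cou) (b : B) (X Y : L) :
    st.lam cop (st.mkOp (st.t b * X) Y) =
      st.tMul b (st.lam cop (st.mkOp X Y)) := by
  obtain ⟨S, hS⟩ := exists_sum_mk2 (cop X)
  simp only [hb.lam_mkOp, hb.comul_t_mul_sum hS, hS, map_sum, mulRight_mk2, tMul_mk2,
    mul_assoc]

theorem IsLeftBialgebroid.lam_mkOp_mul_s (hb : st.IsLeftBialgebroid cop cou) (X Y : L) (b : B) :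
    st.lam cop (st.mkOp (X * st.s b) Y) =
      st.mulRight (st.s b) 1 (st.lam cop (st.mkOp X Y)) := by
  obtain ⟨S, hS⟩ := exists_sum_mk2 (cop X)
  simp only [hb.lam_mkOp, hb.comul_mul_s_sum hS, hS, map_sum, mulRight_mk2, mul_one]

theorem IsLeftBialgebroid.lam_mkOp_s_mul (hb : st.IsLeftBialgebroid cop cou) (X Y : L) (b : B) :
    st.lam cop (st.mkOp X (st.s b * Y)) =
      st.mulRight (st.t b) 1 (st.lam cop (st.mkOp X Y)) := by
  obtain ⟨S, hS⟩ := exists_sum_mk2 (cop X)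
  have h := congrArg (st.mulRight 1 Y) (hb.takeuchi_sum hS b)
  simp only [map_sum, mulRight_mk2, mul_one, mul_assoc] at h
  simp only [hb.lam_mkOp, hS, map_sum, mulRight_mk2, mul_one]
  exact h.symm

theorem IsLeftBialgebroid.lam_mkOp_mul_mul (hb : st.IsLeftBialgebroid cop cou) {X : L}
    {S : Finset (L × L)} (hS : cop X = ∑ p ∈ S, st.mk2 p.1 p.2) (Y M N : L) :
    st.lam cop (st.mkOp (X * Y) (N * M)) = st.mulRight 1 M
      (st.mulLeft S (st.lam cop (st.mkOp Y N))) := by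
  obtain ⟨T, hT⟩ := exists_sum_mk2 (cop Y)
  simp only [hb.lam_mkOp, hb.comul_mul_sum hS hT, hT, map_sum, mulRight_mk2,
    hb.mulLeft_mk2 hS, mul_one, mul_assoc]

/-- The expression `ε(X₊ t(σ(X₋)))`, whose image under `(σ ∘ s)⁻¹` is the value at `X` of the
inverse of `σ`. -/
noncomputable def twistedCounit (st : BgdST k B L) (cop : L →ₗ[k] st.T2) (cou σ : L →ₗ[k] B)
    (X : L) : B :=
  st.liftOp (fun p m => cou (p * st.t (σ m))) (st.plusMinus cop X)

theorem IsLeftBisection.liftOp_counit_mk (hσ : st.IsLeftBisection σ) (cou : L →ₗ[k] B) (p m : L) :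
    st.liftOp (fun p m => cou (p * st.t (σ m))) (st.mkOp p m) = cou (p * st.t (σ m)) := by
  refine liftOp_mk ⟨?_, ?_, ?_, ?_⟩ ?_ p m <;> intros <;>
    simp [mul_add, add_mul, hσ.t_prop, st.t_mul, mul_assoc]

theorem IsLeftHopf.exists_plusMinus (hH : st.IsLeftHopf cop) (X : L) : ∃ T : Finset (L × L),
    ∑ q ∈ T, st.lam cop (st.mkOp q.1 q.2) = st.mk2 X 1 := by
  obtain ⟨z, hz⟩ := hH.2 (st.mk2 X 1)
  obtain ⟨T, rfl⟩ := exists_sum_mkOp z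
  exact ⟨T, by rw [← hz, map_sum]⟩

theorem IsLeftHopf.twistedCounit_eq_liftOp (hH : st.IsLeftHopf cop) (cou σ : L →ₗ[k] B) {X : L}
    {z : st.TOp} (hz : st.lam cop z = st.mk2 X 1) :
    st.twistedCounit cop cou σ X = st.liftOp (fun p m => cou (p * st.t (σ m))) z := by
  rw [twistedCounit, plusMinus, ← hz, Function.leftInverse_invFun hH.1 z]

theorem IsLeftHopf.twistedCounit_eq_sum (hH : st.IsLeftHopf cop) (cou : L →ₗ[k] B)
    (hσ : st.IsLeftBisection σ) {X : L} {ι : Type*} {T : Finset ι} {p m : ι → L}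
    (hT : ∑ i ∈ T, st.lam cop (st.mkOp (p i) (m i)) = st.mk2 X 1) :
    st.twistedCounit cop cou σ X = ∑ i ∈ T, cou (p i * st.t (σ (m i))) := by
  rw [← map_sum] at hT
  rw [hH.twistedCounit_eq_liftOp cou σ hT, map_sum]
  simp only [hσ.liftOp_counit_mk]

theorem IsLeftHopf.sum_counit_mul_t (hH : st.IsLeftHopf cop) (hb : st.IsLeftBialgebroid cop cou)
    (hσ : st.IsLeftBisection σ) {X : L} {T : Finset (L × L)}
    (hT : ∑ q ∈ T, st.lam cop (st.mkOp q.1 q.2) = st.mk2 X 1) (b : B) :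
    ∑ q ∈ T, cou (q.1 * st.t (σ (q.2 * st.t b))) = st.twistedCounit cop cou σ X * b := by
  have h : ∑ q ∈ T, st.mkOp q.1 (q.2 * st.t b) = ∑ q ∈ T, st.mkOp (st.t b * q.1) q.2 := by
    apply hH.1
    simp only [map_sum, hb.lam_mkOp_mul_right, hb.lam_mkOp_t_mul]
    simp only [← map_sum, hT, mulRight_mk2, tMul_mk2, mul_one, one_mul]
  have h' := congrArg (st.liftOp (fun p m => cou (p * st.t (σ m)))) h
  simp only [map_sum, hσ.liftOp_counit_mk] at h'
  rw [h', hH.twistedCounit_eq_sum cou hσ hT, Finset.sum_mul]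
  simp only [mul_assoc, hb.counit_t]

theorem IsLeftHopf.twistedCounit_t_mul (hH : st.IsLeftHopf cop)
    (hb : st.IsLeftBialgebroid cop cou) (hσ : st.IsLeftBisection σ) (b : B) (X : L) :
    st.twistedCounit cop cou σ (st.t b * X) = st.twistedCounit cop cou σ X * σ (st.s b) := by
  obtain ⟨T, hT⟩ := hH.exists_plusMinus X
  rw [← hH.sum_counit_mul_t hb hσ hT, hH.twistedCounit_eq_sum cou hσ (T := T) (p := fun q => q.1)
    (m := fun q => q.2 * st.s b)]
  · simp only [hσ.mul_s]
  · simp only [hb.lam_mkOp_mul_right]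
    simp only [← map_sum, hT, mulRight_mk2, mul_one, one_mul, mk2_balanced]

theorem IsLeftHopf.twistedCounit_s (hH : st.IsLeftHopf cop) (hb : st.IsLeftBialgebroid cop cou)
    (hσ : st.IsLeftBisection σ) (b : B) : st.twistedCounit cop cou σ (st.s b) = b := by
  rw [hH.twistedCounit_eq_sum cou hσ (T := {()}) (p := fun _ => st.s b) (m := fun _ => 1)]
  · simp [hσ.unital, st.t_one, hb.counit_s_eq]
  · simp [hb.lam_mkOp, hb.comul_s_eq, mulRight_mk2]

theorem IsLeftHopf.twistedCounit_mul_s (hH : st.IsLeftHopf cop)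
    (hb : st.IsLeftBialgebroid cop cou) (hσ : st.IsLeftBisection σ) {X : L} {T : Finset (L × L)}
    (hT : ∑ q ∈ T, st.lam cop (st.mkOp q.1 q.2) = st.mk2 X 1) (b : B) :
    st.twistedCounit cop cou σ (X * st.s b) = ∑ q ∈ T, cou (q.1 * st.s (b * σ q.2)) := by
  rw [hH.twistedCounit_eq_sum cou hσ (T := T) (p := fun q => q.1 * st.s b) (m := fun q => q.2)]
  · simp only [hb.counit_mul_t, map_mul, ← mul_assoc]
  · simp only [hb.lam_mkOp_mul_s]
    simp only [← map_sum, hT, mulRight_mk2, mul_one]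

theorem IsLeftHopf.twistedCounit_mul_t (hH : st.IsLeftHopf cop)
    (hb : st.IsLeftBialgebroid cop cou) (hσ : st.IsLeftBisection σ) (X : L) (b : B) :
    st.twistedCounit cop cou σ (X * st.t b) =
      st.twistedCounit cop cou σ (X * st.s (σ (st.s b))) := by
  obtain ⟨T, hT⟩ := hH.exists_plusMinus X
  rw [hH.twistedCounit_mul_s hb hσ hT, hH.twistedCounit_eq_sum cou hσ (T := T)
    (p := fun q => q.1) (m := fun q => st.s b * q.2)]
  · simp only [hb.counit_mul_t, hσ.s_mul_left]
  · simp only [hb.lam_mkOp_s_mul]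
    simp only [← map_sum, hT, mulRight_mk2, mul_one]

theorem IsLeftHopf.twistedCounit_mul (hH : st.IsLeftHopf cop)
    (hb : st.IsLeftBialgebroid cop cou) (hσ : st.IsLeftBisection σ) (X Y : L) :
    st.twistedCounit cop cou σ (X * Y) =
      st.twistedCounit cop cou σ (X * st.s (st.twistedCounit cop cou σ Y)) := by
  obtain ⟨T, hT⟩ := hH.exists_plusMinus X
  obtain ⟨U, hU⟩ := hH.exists_plusMinus Y
  rw [hH.twistedCounit_mul_s hb hσ hT, hH.twistedCounit_eq_sum cou hσ (T := T ×ˢ U)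
    (p := fun i => i.1.1 * i.2.1) (m := fun i => i.2.2 * i.1.2), Finset.sum_product]
  · refine Finset.sum_congr rfl fun p _ => ?_
    rw [← hH.sum_counit_mul_t hb hσ hU]
    simp only [map_sum, Finset.mul_sum, hb.counit_char_s, mul_assoc, ← hσ.prod_t]
  · have h (p : L × L) : ∑ q ∈ U, st.lam cop (st.mkOp (p.1 * q.1) (q.2 * p.2)) =
        st.mulRight Y 1 (st.lam cop (st.mkOp p.1 p.2)) := by
      obtain ⟨S, hS⟩ := exists_sum_mk2 (cop p.1)
      simp only [hb.lam_mkOp_mul_mul hS]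
      simp only [← map_sum, hU, hb.mulLeft_mk2 hS]
      simp only [hb.lam_mkOp, hS, map_sum, mulRight_mk2, mul_one]
    rw [Finset.sum_product]
    simp only [h]
    simp only [← map_sum, hT, mulRight_mk2, mul_one]

theorem IsLeftHopf.sum_twistedCounit_mul (hH : st.IsLeftHopf cop)
    (hb : st.IsLeftBialgebroid cop cou) (hσ : st.IsLeftBisection σ) {X : L} {S : Finset (L × L)}
    (hS : cop X = ∑ p ∈ S, st.mk2 p.1 p.2) :
    ∑ p ∈ S, st.twistedCounit cop cou σ p.1 * σ p.2 = cou X := by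
  choose T hT using hH.exists_plusMinus
  have h : ∑ p ∈ S, ∑ q ∈ T p.1, st.mkOp q.1 (q.2 * p.2) = st.mkOp X 1 := by
    apply hH.1
    simp only [map_sum, hb.lam_mkOp_mul_right]
    simp only [← map_sum, hT]
    simp only [hb.lam_mkOp, hS, map_sum, mulRight_mk2, mul_one, one_mul]
  have h' := congrArg (st.liftOp (fun p m => cou (p * st.t (σ m)))) h
  simp only [map_sum, hσ.liftOp_counit_mk, hσ.unital, st.t_one, mul_one] at h'
  rw [← h']
  refine Finset.sum_congr rfl fun p _ => ?_
  rw [← hH.sum_counit_mul_t hb hσ (hT p.1)]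
  simp only [← hσ.prod_t]

theorem IsLeftHopf.exists_linearMap_inverse (hH : st.IsLeftHopf cop) (cou : L →ₗ[k] B)
    (hσ : st.IsLeftBisection σ) : ∃ σi : L →ₗ[k] B, ∀ X : L,
      σi X = Function.invFun (fun b => σ (st.s b)) (st.twistedCounit cop cou σ X) := by
  let φ : B ≃ₗ[k] B := LinearEquiv.ofBijective (σ ∘ₗ st.s.toLinearMap) hσ.s_bij
  let e : st.TOp ≃ₗ[k] st.T2 := LinearEquiv.ofBijective (st.lam cop) hH
  let i : L →ₗ[k] st.T2 :=
    { toFun := fun X => st.mk2 X 1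
      map_add' := fun X Y => mk2_add_left X Y 1
      map_smul' := fun c X => mk2_smul_left c X 1 }
  refine ⟨φ.symm.toLinearMap ∘ₗ st.liftOp (fun p m => cou (p * st.t (σ m))) ∘ₗ
    e.symm.toLinearMap ∘ₗ i, fun X => hσ.s_bij.1 ?_⟩
  beta_reduce
  rw [hσ.apply_s_invFun, hH.twistedCounit_eq_liftOp cou σ (z := e.symm (i X))
    (e.apply_symm_apply (i X))]
  exact φ.apply_symm_apply _

theorem IsLeftBisection.inverse (hH : st.IsLeftHopf cop) (hb : st.IsLeftBialgebroid cop cou)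
    (hσ : st.IsLeftBisection σ) {σi : L →ₗ[k] B}
    (h : ∀ X, σ (st.s (σi X)) = st.twistedCounit cop cou σ X) : st.IsLeftBisection σi := by
  have hs (b : B) : σ (st.s (σi (st.s b))) = b := by rw [h, hH.twistedCounit_s hb hσ]
  have inj {a b : B} (hab : σ (st.s a) = σ (st.s b)) : a = b := hσ.s_bij.1 hab
  have hps (X Y : L) (b : B) (hY : σi (st.s b) = σi Y) : σi (X * Y) = σi (X * st.s b) :=
    inj (by rw [h, h, hH.twistedCounit_mul hb hσ, ← h Y, ← hY, hs])
  refine isLeftBisection_of_prod_s ?_ ?_ ?_ ⟨?_, ?_⟩ ?_ hps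
  · apply inj
    simpa [hσ.unital] using hs 1
  · intro b X
    apply inj
    rw [h, hH.twistedCounit_t_mul hb hσ, hσ.s_mul, h]
  · intro a b
    apply inj
    rw [hs, hσ.s_mul, hs, hs]
  · intro a b hab
    rw [← hs a, ← hs b]
    exact congrArg (fun c => σ (st.s c)) hab
  · exact fun b => ⟨σ (st.s b), inj (hs _)⟩
  · intro X Y
    apply inj
    rw [h, h, hH.twistedCounit_mul hb hσ, hH.twistedCounit_mul_t hb hσ, h]

theorem IsLeftBisection.bconv_inverse (hH : st.IsLeftHopf cop)
    (hb : st.IsLeftBialgebroid cop cou) (hσ : st.IsLeftBisection σ) {σi : L →ₗ[k] B}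
    (h : ∀ X, σ (st.s (σi X)) = st.twistedCounit cop cou σ X) : st.bconv cop σ σi = cou := by
  ext X
  obtain ⟨S, hS⟩ := exists_sum_mk2 (cop X)
  rw [(hσ.inverse hH hb h).bconv_eq_sum σ hS, ← hH.sum_twistedCounit_mul hb hσ hS]
  simp only [hσ.s_mul_left, h]

theorem IsLeftBisection.exists_inverse (hH : st.IsLeftHopf cop)
    (hb : st.IsLeftBialgebroid cop cou) (hσ : st.IsLeftBisection σ) : ∃ σi : L →ₗ[k] B,
      (∀ X : L, σi X = Function.invFun (fun b => σ (st.s b)) (st.twistedCounit cop cou σ X)) ∧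
      st.IsLeftBisection σi ∧ st.bconv cop σ σi = cou := by
  obtain ⟨σi, hi⟩ := hH.exists_linearMap_inverse cou hσ
  have h (X : L) : σ (st.s (σi X)) = st.twistedCounit cop cou σ X := by
    rw [hi, hσ.apply_s_invFun]
  exact ⟨σi, hi, hσ.inverse hH hb h, hσ.bconv_inverse hH hb h⟩

end Hopf

end BgdST

/-- Let `L` be a left Hopf algebroid over `B`.  Then the set of left bisections
of `L` is a group under the convolution product `(σ*η)(X) = σ(s(η(X₍₁₎)) X₍₂₎)`, with unit the
counit `ε`, and the inverse of a left bisection `σ` is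
`σ⁻¹(X) = (σ∘s)⁻¹(ε(X₊ t(σ(X₋))))`. -/
theorem left_bisections_form_group
    {k : Type*} [Field k] {B L : Type*} [Ring B] [Algebra k B] [Ring L] [Algebra k L]
    (st : BgdST k B L) (cop : L →ₗ[k] st.T2) (cou : L →ₗ[k] B)
    (hbgd : st.IsLeftBialgebroid cop cou) (hHopf : st.IsLeftHopf cop) :
    (∀ σ η : L →ₗ[k] B, st.IsLeftBisection σ → st.IsLeftBisection η →
      st.IsLeftBisection (st.bconv cop σ η)) ∧
    st.IsLeftBisection cou ∧
    (∀ σ η ρ : L →ₗ[k] B, st.IsLeftBisection σ → st.IsLeftBisection η → st.IsLeftBisection ρ →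
      st.bconv cop (st.bconv cop σ η) ρ = st.bconv cop σ (st.bconv cop η ρ)) ∧
    (∀ σ : L →ₗ[k] B, st.IsLeftBisection σ →
      st.bconv cop σ cou = σ ∧ st.bconv cop cou σ = σ) ∧
    (∀ σ : L →ₗ[k] B, st.IsLeftBisection σ → ∃ σi : L →ₗ[k] B,
      (∀ X : L, σi X = Function.invFun (fun b => σ (st.s b))
          (st.liftOp (fun p m => cou (p * st.t (σ m))) (st.plusMinus cop X))) ∧
      st.IsLeftBisection σi ∧ st.bconv cop σ σi = cou ∧ st.bconv cop σi σ = cou) := by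
  refine ⟨fun σ η hσ hη => hσ.bconv hbgd hη, hbgd.isLeftBisection_counit,
    fun σ η ρ _ hη hρ => hη.bconv_assoc hbgd hρ σ (hη.bconv hbgd hρ),
    fun σ hσ => ⟨BgdST.IsLeftBisection.bconv_counit hbgd σ, hσ.counit_bconv hbgd⟩, ?_⟩
  intro σ hσ
  obtain ⟨η, hη, hηb, hση⟩ := hσ.exists_inverse hHopf hbgd
  obtain ⟨ρ, -, hρb, hηρ⟩ := hηb.exists_inverse hHopf hbgd
  have h : σ = ρ := by
    rw [← BgdST.IsLeftBisection.bconv_counit hbgd σ, ← hηρ,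
      ← hηb.bconv_assoc hbgd hρb σ (hηb.bconv hbgd hρb), hση, hρb.counit_bconv hbgd]
  exact ⟨η, hη, hηb, hση, h ▸ hηρ⟩
end

section
/- For every left bisection σ of a left Hopf algebroid L over B, the pair (Ad^L_σ, ad^L_σ) defined by Ad^L_σ(X) := s(σ(X₍₁₎)) X₍₂₎₊ t(σ(X₍₂₎₋)) and ad^L_σ := σ∘s is an automorphism of the left bialgebroid L. Moreover Ad^L_σ ∘ Ad^L_η = Ad^L_{σ*η} for any two left bisections σ, η, where (σ*η)(X) := σ(s(η(X₍₁₎)) X₍₂₎). -/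
open scoped TensorProduct
open TensorProduct

noncomputable section
attribute [local instance] Classical.propDecidable

variable (k : Type*) [Field k]

end

namespace BgdST

section Aux

variable {k : Type*} [Field k] {B L : Type*} [Ring B] [Algebra k B] [Ring L] [Algebra k L]
variable (st : BgdST k B L)
variable {Q R : Type*} [AddCommGroup Q] [Module k Q] [AddCommGroup R] [Module k R]

theorem qtlift_mk_s1 {M N : Type*} [AddCommGroup M] [Module k M] [AddCommGroup N] [Module k N]
    (p : Submodule k (M ⊗[k] N)) (f : M → N → Q) (F : ((M ⊗[k] N) ⧸ p) →ₗ[k] Q)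
    (hF : ∀ x y, F (Submodule.Quotient.mk (x ⊗ₜ[k] y)) = f x y) (x : M) (y : N) :
    qtlift k p f (Submodule.Quotient.mk (x ⊗ₜ[k] y)) = f x y := by
  have h : ∃ F : ((M ⊗[k] N) ⧸ p) →ₗ[k] Q,
      ∀ x y, F (Submodule.Quotient.mk (x ⊗ₜ[k] y)) = f x y := ⟨F, hF⟩
  rw [qtlift, dif_pos h]
  exact h.choose_spec x y

/-- Bilinearity of a map written as a function of two variables. -/
structure Bilin (f : L → L → Q) : Prop where
  add_left : ∀ x x' y, f (x + x') y = f x y + f x' y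
  add_right : ∀ x y y', f x (y + y') = f x y + f x y'
  smul_left : ∀ (c : k) x y, f (c • x) y = c • f x y
  smul_right : ∀ (c : k) x y, f x (c • y) = c • f x y

/-- Bilinear maps that descend to `L ⊗_B L`. -/
structure Bal (f : L → L → Q) : Prop extends Bilin (k := k) f where
  bal : ∀ a x y, f (st.t a * x) y = f x (st.s a * y)

/-- Bilinear maps that descend to `L ⊗_{B^{op}} L`. -/
structure BalOp (f : L → L → Q) : Prop extends Bilin (k := k) f where
  bal : ∀ a x y, f (x * st.t a) y = f x (st.t a * y)

variable {st}

/-- The linear map on `L ⊗ L` induced by a bilinear map. -/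
def Bilin.toLin {f : L → L → Q} (hf : Bilin (k := k) f) : L ⊗[k] L →ₗ[k] Q :=
  TensorProduct.lift
    (LinearMap.mk₂ k f hf.add_left hf.smul_left hf.add_right hf.smul_right)

theorem Bilin.toLin_tmul {f : L → L → Q} (hf : Bilin (k := k) f) (x y : L) :
    hf.toLin (x ⊗ₜ[k] y) = f x y :=
  TensorProduct.lift.tmul x y

theorem lift2_mk2 {f : L → L → Q} (hf : st.Bal f) (x y : L) :
    st.lift2 f (st.mk2 x y) = f x y := by
  refine qtlift_mk_s1 st.rel f (Submodule.liftQ _ hf.toLin ?_) ?_ x y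
  · refine Submodule.span_le.2 ?_
    rintro _ ⟨a, X, Y, rfl⟩
    simp [Bilin.toLin_tmul, hf.bal]
  · exact hf.toLin_tmul

theorem liftOp_mkOp {f : L → L → Q} (hf : st.BalOp f) (x y : L) :
    st.liftOp f (st.mkOp x y) = f x y := by
  refine qtlift_mk_s1 st.relOp f (Submodule.liftQ _ hf.toLin ?_) ?_ x y
  · refine Submodule.span_le.2 ?_
    rintro _ ⟨a, X, Y, rfl⟩
    simp [Bilin.toLin_tmul, hf.bal]
  · exact hf.toLin_tmul

theorem ext2 {F G : st.T2 →ₗ[k] Q} (h : ∀ x y, F (st.mk2 x y) = G (st.mk2 x y)) : F = G :=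
  Submodule.linearMap_qext _ (TensorProduct.ext' h)

theorem extOp {F G : st.TOp →ₗ[k] Q} (h : ∀ x y, F (st.mkOp x y) = G (st.mkOp x y)) : F = G :=
  Submodule.linearMap_qext _ (TensorProduct.ext' h)

theorem mk2_bal : st.Bal st.mk2 where
  add_left x x' y := by simp [mk2, TensorProduct.add_tmul]
  add_right x y y' := by simp [mk2, TensorProduct.tmul_add]
  smul_left c x y := by simp [mk2, ← TensorProduct.smul_tmul', Submodule.Quotient.mk_smul]
  smul_right c x y := by simp [mk2]
  bal a x y := (Submodule.Quotient.eq _).2 (Submodule.subset_span ⟨a, x, y, rfl⟩)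

theorem mkOp_bal : st.BalOp st.mkOp where
  add_left x x' y := by simp [mkOp, TensorProduct.add_tmul]
  add_right x y y' := by simp [mkOp, TensorProduct.tmul_add]
  smul_left c x y := by simp [mkOp, ← TensorProduct.smul_tmul', Submodule.Quotient.mk_smul]
  smul_right c x y := by simp [mkOp]
  bal a x y := (Submodule.Quotient.eq _).2 (Submodule.subset_span ⟨a, x, y, rfl⟩)

theorem Bal.comp {f : L → L → Q} (hf : st.Bal f) (F : Q →ₗ[k] R) :
    st.Bal (fun x y => F (f x y)) where
  add_left x x' y := by simp [hf.add_left]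
  add_right x y y' := by simp [hf.add_right]
  smul_left c x y := by simp [hf.smul_left]
  smul_right c x y := by simp [hf.smul_right]
  bal a x y := by simp [hf.bal]

theorem map_lift2 {f : L → L → Q} (hf : st.Bal f) (F : Q →ₗ[k] R) (z : st.T2) :
    F (st.lift2 f z) = st.lift2 (fun x y => F (f x y)) z := by
  refine LinearMap.congr_fun (f := F ∘ₗ st.lift2 f) (ext2 fun x y => ?_) z
  simp [lift2_mk2 hf, lift2_mk2 (hf.comp F)]

theorem lift2_lift2 {f : L → L → st.T2} (hf : st.Bal f) {g : L → L → Q} (z : st.T2) :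
    st.lift2 g (st.lift2 f z) = st.lift2 (fun x y => st.lift2 g (f x y)) z :=
  map_lift2 hf _ z

theorem lift2_mk_s1 (z : st.T2) : st.lift2 st.mk2 z = z := by
  refine LinearMap.congr_fun (g := LinearMap.id) (ext2 fun x y => ?_) z
  simp [lift2_mk2 mk2_bal]

/-- The map `f ⊗ g` on `L ⊗_B L`, for maps `f`, `g` compatible with a twist of `B`. -/
theorem mk2_map_bal {f g : L →ₗ[k] L} (ψ : B → B)
    (hf : ∀ a x, f (st.t a * x) = st.t (ψ a) * f x)
    (hg : ∀ a x, g (st.s a * x) = st.s (ψ a) * g x) :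
    st.Bal (fun x y => st.mk2 (f x) (g y)) where
  add_left x x' y := by simp [mk2_bal.add_left]
  add_right x y y' := by simp [mk2_bal.add_right]
  smul_left c x y := by simp [mk2_bal.smul_left]
  smul_right c x y := by simp [mk2_bal.smul_right]
  bal a x y := by simp [hf, hg, mk2_bal.bal]

theorem mk2_mul_bal (Y : L) : st.Bal (fun x y => st.mk2 x (y * Y)) where
  add_left x x' y := by simp [mk2_bal.add_left]
  add_right x y y' := by simp [mk2_bal.add_right, add_mul]
  smul_left c x y := by simp [mk2_bal.smul_left]
  smul_right c x y := by simp [mk2_bal.smul_right]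
  bal a x y := by simp [mk2_bal.bal, mul_assoc]

theorem mkOp_mul_bal (Y : L) : st.BalOp (fun x y => st.mkOp x (y * Y)) where
  add_left x x' y := by simp [mkOp_bal.add_left]
  add_right x y y' := by simp [mkOp_bal.add_right, add_mul]
  smul_left c x y := by simp [mkOp_bal.smul_left]
  smul_right c x y := by simp [mkOp_bal.smul_right]
  bal a x y := by simp [mkOp_bal.bal, mul_assoc]

theorem mk2_s_mul_bal (b : B) : st.Bal (fun x y => st.mk2 (st.s b * x) y) :=
  mk2_map_bal (f := LinearMap.mulLeft k (st.s b)) (g := LinearMap.id) id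
    (fun a x => by simp [← mul_assoc, st.st_comm]) (fun a x => by simp)

theorem mk2_t_mul_bal (b : B) : st.Bal (fun x y => st.mk2 x (st.t b * y)) :=
  mk2_map_bal (f := LinearMap.id) (g := LinearMap.mulLeft k (st.t b)) id
    (fun a x => by simp) (fun a x => by simp [← mul_assoc, st.st_comm])

theorem mk2_mul_t_bal (b : B) : st.Bal (fun x y => st.mk2 (x * st.t b) y) :=
  mk2_map_bal (f := LinearMap.mulRight k (st.t b)) (g := LinearMap.id) id
    (fun a x => by simp [mul_assoc]) (fun a x => by simp)

/-- Trilinear maps that descend to `L ⊗_B L ⊗_B L`. -/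
structure Bal3 (st : BgdST k B L) (f : L → L → L → Q) : Prop where
  add₁ : ∀ x x' y z, f (x + x') y z = f x y z + f x' y z
  add₂ : ∀ x y y' z, f x (y + y') z = f x y z + f x y' z
  add₃ : ∀ x y z z', f x y (z + z') = f x y z + f x y z'
  smul₁ : ∀ (c : k) x y z, f (c • x) y z = c • f x y z
  smul₂ : ∀ (c : k) x y z, f x (c • y) z = c • f x y z
  smul₃ : ∀ (c : k) x y z, f x y (c • z) = c • f x y z
  bal₁ : ∀ a x y z, f (st.t a * x) y z = f x (st.s a * y) z
  bal₂ : ∀ a x y z, f x (st.t a * y) z = f x y (st.s a * z)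

theorem mk3_bal : Bal3 st st.mk3 where
  add₁ x x' y z := by simp [mk3, TensorProduct.add_tmul]
  add₂ x y y' z := by simp [mk3, TensorProduct.tmul_add, TensorProduct.add_tmul]
  add₃ x y z z' := by simp [mk3, TensorProduct.tmul_add]
  smul₁ c x y z := by simp [mk3, ← TensorProduct.smul_tmul', Submodule.Quotient.mk_smul]
  smul₂ c x y z := by simp [mk3, ← TensorProduct.smul_tmul']
  smul₃ c x y z := by simp [mk3]
  bal₁ a x y z :=
    (Submodule.Quotient.eq _).2 (Submodule.subset_span (Or.inl ⟨a, x, y, z, rfl⟩))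
  bal₂ a x y z :=
    (Submodule.Quotient.eq _).2 (Submodule.subset_span (Or.inr ⟨a, x, y, z, rfl⟩))

theorem Bal3.exists_lift {f : L → L → L → Q} (hf : Bal3 st f) :
    ∃ F : st.T3 →ₗ[k] Q, ∀ x y z, F (st.mk3 x y z) = f x y z := by
  have hb : ∀ x, Bilin (k := k) (f x) := fun x =>
    ⟨hf.add₂ x, hf.add₃ x, fun c y z => hf.smul₂ c x y z, fun c y z => hf.smul₃ c x y z⟩
  let g : L →ₗ[k] (L ⊗[k] L →ₗ[k] Q) :=
    { toFun := fun x => (hb x).toLin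
      map_add' := fun x x' => TensorProduct.ext' fun y z => by
        simp [Bilin.toLin_tmul, hf.add₁]
      map_smul' := fun c x => TensorProduct.ext' fun y z => by
        simp [Bilin.toLin_tmul, hf.smul₁] }
  have hg : ∀ x y z, g x (y ⊗ₜ[k] z) = f x y z := fun x => (hb x).toLin_tmul
  refine ⟨Submodule.liftQ _ (TensorProduct.lift g) ?_, fun x y z => ?_⟩
  · refine Submodule.span_le.2 ?_
    rintro _ (⟨a, X, Y, Z, rfl⟩ | ⟨a, X, Y, Z, rfl⟩)
    · simp [hg, hf.bal₁]
    · simp [hg, hf.bal₂]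
  · exact (TensorProduct.lift.tmul _ _).trans (hg x y z)

theorem Bal3.right {f : L → L → L → Q} (hf : Bal3 st f) (x : L) : st.Bal (f x) where
  add_left := hf.add₂ x
  add_right := hf.add₃ x
  smul_left c := hf.smul₂ c x
  smul_right c := hf.smul₃ c x
  bal a := hf.bal₂ a x

theorem Bal3.left {f : L → L → L → Q} (hf : Bal3 st f) (z : L) :
    st.Bal (fun x y => f x y z) where
  add_left x x' y := hf.add₁ x x' y z
  add_right x y y' := hf.add₂ x y y' z
  smul_left c x y := hf.smul₁ c x y z
  smul_right c x y := hf.smul₂ c x y z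
  bal a x y := hf.bal₁ a x y z

namespace IsLeftBialgebroid

variable {cop : L →ₗ[k] st.T2} {cou : L →ₗ[k] B} (hL : st.IsLeftBialgebroid cop cou)

include hL

theorem lift2_cop_right_bal {f : L → L → L → Q} (hf : Bal3 st f) :
    st.Bal (fun x y => st.lift2 (f x) (cop y)) where
  add_left x x' y := by
    rw [← LinearMap.add_apply]
    refine LinearMap.congr_fun (ext2 fun u v => ?_) _
    simp [lift2_mk2 (hf.right _), hf.add₁]
  add_right x y y' := by simp
  smul_left c x y := by
    rw [← LinearMap.smul_apply]
    refine LinearMap.congr_fun (ext2 fun u v => ?_) _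
    simp [lift2_mk2 (hf.right _), hf.smul₁]
  smul_right c x y := by simp
  bal a x y := by
    rw [hL.comul_s, lift2_lift2 (mk2_s_mul_bal a)]
    congr 2
    funext u v
    rw [lift2_mk2 (hf.right _), hf.bal₁]

theorem lift2_cop_left_bal {f : L → L → L → Q} (hf : Bal3 st f) :
    st.Bal (fun x z => st.lift2 (fun x₁ x₂ => f x₁ x₂ z) (cop x)) where
  add_right x z z' := by
    rw [← LinearMap.add_apply]
    refine LinearMap.congr_fun (ext2 fun u v => ?_) _
    rw [LinearMap.add_apply, lift2_mk2 (hf.left _), lift2_mk2 (hf.left _), lift2_mk2 (hf.left _),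
      hf.add₃]
  add_left x y y' := by simp
  smul_right c x z := by
    rw [← LinearMap.smul_apply]
    refine LinearMap.congr_fun (ext2 fun u v => ?_) _
    rw [LinearMap.smul_apply, lift2_mk2 (hf.left _), lift2_mk2 (hf.left _), hf.smul₃]
  smul_left c x y := by simp
  bal a x z := by
    rw [hL.comul_t, lift2_lift2 (mk2_t_mul_bal a)]
    congr 2
    funext u v
    rw [lift2_mk2 (hf.left _), hf.bal₂]

/-- Coassociativity evaluated on an arbitrary balanced trilinear map. -/
theorem coassoc_lift {f : L → L → L → Q} (hf : Bal3 st f) (X : L) :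
    st.lift2 (fun x y => st.lift2 (f x) (cop y)) (cop X) =
      st.lift2 (fun x z => st.lift2 (fun x₁ x₂ => f x₁ x₂ z) (cop x)) (cop X) := by
  obtain ⟨F, hF⟩ := hf.exists_lift
  have h := congrArg F (hL.coassoc X)
  rw [map_lift2 (hL.lift2_cop_right_bal mk3_bal), map_lift2 (hL.lift2_cop_left_bal mk3_bal)] at h
  simpa only [map_lift2 (mk3_bal.right _), map_lift2 (mk3_bal.left _), hF] using h

theorem takeuchi_lift {f : L → L → Q} (hf : st.Bal f) (b : B) (X : L) :
    st.lift2 (fun x y => f (x * st.t b) y) (cop X) =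
      st.lift2 (fun x y => f x (y * st.s b)) (cop X) := by
  have h := congrArg (st.lift2 f) (hL.takeuchi b X)
  rw [lift2_lift2 (mk2_mul_t_bal b), lift2_lift2 (mk2_mul_bal _)] at h
  simpa only [lift2_mk2 hf] using h

theorem comul_mul_mk (X Y : L) (z w : L ⊗[k] L) (hz : Submodule.Quotient.mk z = cop X)
    (hw : Submodule.Quotient.mk w = cop Y) :
    cop (X * Y) = Submodule.Quotient.mk (z * w) := by
  have hleft : ∀ z w : L ⊗[k] L, z ∈ st.rel → z * w ∈ st.rel := by
    intro z w hz
    induction w using TensorProduct.induction_on with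
    | zero => simp
    | add w₁ w₂ h₁ h₂ => rw [mul_add]; exact add_mem h₁ h₂
    | tmul p q =>
      have : st.rel ≤ st.rel.comap (LinearMap.mulRight k (p ⊗ₜ[k] q)) := by
        refine Submodule.span_le.2 ?_
        rintro _ ⟨a, x, y, rfl⟩
        exact Submodule.subset_span ⟨a, x * p, y * q, by simp [sub_mul, mul_assoc]⟩
      exact this hz
  have hright : ∀ z w : L ⊗[k] L, Submodule.Quotient.mk z = cop X → w ∈ st.rel →
      z * w ∈ st.rel := by
    intro z w hz hw
    have : st.rel ≤ st.rel.comap (LinearMap.mulLeft k z) := by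
      refine Submodule.span_le.2 ?_
      rintro _ ⟨a, x, y, rfl⟩
      have hT := hL.takeuchi a X
      have e₁ : st.lift2 (fun x y => st.mk2 (x * st.t a) y) ∘ₗ st.rel.mkQ =
          st.rel.mkQ ∘ₗ LinearMap.mulRight k (st.t a ⊗ₜ[k] (1 : L)) :=
        TensorProduct.ext' fun p q => by
          simpa [mk2] using lift2_mk2 (mk2_mul_t_bal a) p q
      have e₂ : st.lift2 (fun x y => st.mk2 x (y * st.s a)) ∘ₗ st.rel.mkQ =
          st.rel.mkQ ∘ₗ LinearMap.mulRight k ((1 : L) ⊗ₜ[k] st.s a) :=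
        TensorProduct.ext' fun p q => by
          simpa [mk2] using lift2_mk2 (mk2_mul_bal (st.s a)) p q
      have h₁ := LinearMap.congr_fun e₁ z
      have h₂ := LinearMap.congr_fun e₂ z
      rw [← hz] at hT
      have h := (h₁.symm.trans hT).trans h₂
      have h' := hleft _ (x ⊗ₜ[k] y) ((Submodule.Quotient.eq _).1 h)
      simpa [sub_mul, mul_sub, mul_assoc] using h'
    exact this hw
  rw [hL.comul_mul]
  have h : ∃ u : st.T2, ∀ zr wr : L ⊗[k] L, Submodule.Quotient.mk zr = cop X →
      Submodule.Quotient.mk wr = cop Y → Submodule.Quotient.mk (zr * wr) = u := by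
    refine ⟨Submodule.Quotient.mk (z * w), fun z' w' hz' hw' => (Submodule.Quotient.eq _).2 ?_⟩
    have h₁ := hleft (z' - z) w' ((Submodule.Quotient.eq _).1 (hz'.trans hz.symm))
    have h₂ := hright z (w' - w) hz ((Submodule.Quotient.eq _).1 (hw'.trans hw.symm))
    have := add_mem h₁ h₂
    simpa [sub_mul, mul_sub] using this
  rw [mulT2, dif_pos h]
  exact (h.choose_spec z w hz hw).symm

/-- A criterion for a map of the form `X ↦ f(X₍₁₎, X₍₂₎)` to be multiplicative. -/
theorem lift2_cop_mul {f : L → L → L} (hf : st.Bal f)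
    (h : ∀ X y₁ y₂, st.lift2 (fun x₁ x₂ => f (x₁ * y₁) (x₂ * y₂)) (cop X) =
      st.lift2 f (cop X) * f y₁ y₂)
    (hb : ∀ y₁ y₂, st.Bal (fun x₁ x₂ => f (x₁ * y₁) (x₂ * y₂))) (X Y : L) :
    st.lift2 f (cop (X * Y)) = st.lift2 f (cop X) * st.lift2 f (cop Y) := by
  obtain ⟨z, hz⟩ := Submodule.Quotient.mk_surjective _ (cop X)
  obtain ⟨w, hw⟩ := Submodule.Quotient.mk_surjective _ (cop Y)
  rw [hL.comul_mul_mk X Y z w hz hw, ← hw]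
  clear hw
  induction w using TensorProduct.induction_on with
  | zero => simp
  | add w₁ w₂ h₁ h₂ => simp only [mul_add, Submodule.Quotient.mk_add, map_add, h₁, h₂]
  | tmul y₁ y₂ =>
    have e : st.lift2 f ∘ₗ st.rel.mkQ ∘ₗ LinearMap.mulRight k (y₁ ⊗ₜ[k] y₂) =
        st.lift2 (fun x₁ x₂ => f (x₁ * y₁) (x₂ * y₂)) ∘ₗ st.rel.mkQ :=
      TensorProduct.ext' fun p q => by
        have h₁ := lift2_mk2 hf (p * y₁) (q * y₂)
        have h₂ := lift2_mk2 (hb y₁ y₂) p q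
        simpa [mk2] using h₁.trans h₂.symm
    have e' := LinearMap.congr_fun e z
    have h₃ := h X y₁ y₂
    rw [← hz] at h₃ ⊢
    have h₄ := lift2_mk2 hf y₁ y₂
    rw [mk2] at h₄
    rw [h₄]
    exact e'.trans h₃

theorem comul_of_t (b : B) : cop (st.t b) = st.mk2 1 (st.t b) := by
  have h := hL.comul_t b 1
  rw [hL.comul_one, lift2_mk2 (mk2_t_mul_bal b)] at h
  simpa using h

theorem comul_mul_t (X : L) (b : B) :
    cop (X * st.t b) = st.lift2 (fun x y => st.mk2 x (y * st.t b)) (cop X) := by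
  obtain ⟨z, hz⟩ := Submodule.Quotient.mk_surjective _ (cop X)
  rw [hL.comul_mul_mk X _ z _ hz (hL.comul_of_t b).symm, ← hz]
  have e : st.rel.mkQ ∘ₗ LinearMap.mulRight k ((1 : L) ⊗ₜ[k] st.t b) =
      st.lift2 (fun x y => st.mk2 x (y * st.t b)) ∘ₗ st.rel.mkQ :=
    TensorProduct.ext' fun p q => by
      simpa [mk2] using (lift2_mk2 (mk2_mul_bal (st.t b)) p q).symm
  exact LinearMap.congr_fun e z

theorem lam_bal : st.BalOp (fun X Y => st.lift2 (fun x₁ x₂ => st.mk2 x₁ (x₂ * Y)) (cop X)) where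
  add_left x x' y := by simp
  smul_left c x y := by simp
  add_right x y y' := by
    rw [← LinearMap.add_apply]
    refine LinearMap.congr_fun (ext2 fun u v => ?_) _
    rw [LinearMap.add_apply, lift2_mk2 (mk2_mul_bal _), lift2_mk2 (mk2_mul_bal _),
      lift2_mk2 (mk2_mul_bal _), mul_add, mk2_bal.add_right]
  smul_right c x y := by
    rw [← LinearMap.smul_apply]
    refine LinearMap.congr_fun (ext2 fun u v => ?_) _
    rw [LinearMap.smul_apply, lift2_mk2 (mk2_mul_bal _), lift2_mk2 (mk2_mul_bal _),
      mul_smul_comm, mk2_bal.smul_right]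
  bal a x y := by
    rw [hL.comul_mul_t, lift2_lift2 (mk2_mul_bal _)]
    simp only [lift2_mk2 (mk2_mul_bal _), mul_assoc]

theorem lam_mkOp_s1 (X Y : L) :
    st.lam cop (st.mkOp X Y) = st.lift2 (fun x₁ x₂ => st.mk2 x₁ (x₂ * Y)) (cop X) :=
  liftOp_mkOp hL.lam_bal X Y

/-- The canonical map is right `L`-linear. -/
theorem lam_mul (Y : L) (z : st.TOp) :
    st.lam cop (st.liftOp (fun p q => st.mkOp p (q * Y)) z) =
      st.lift2 (fun x y => st.mk2 x (y * Y)) (st.lam cop z) := by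
  refine LinearMap.congr_fun (f := st.lam cop ∘ₗ st.liftOp (fun p q => st.mkOp p (q * Y)))
    (g := st.lift2 (fun x y => st.mk2 x (y * Y)) ∘ₗ st.lam cop) (extOp fun p q => ?_) z
  simp only [LinearMap.comp_apply, liftOp_mkOp (mkOp_mul_bal Y), hL.lam_mkOp_s1,
    lift2_lift2 (mk2_mul_bal _), lift2_mk2 (mk2_mul_bal _), mul_assoc]

end IsLeftBialgebroid

end Aux

end BgdST

namespace BgdST

section Bisection

variable {k : Type*} [Field k] {B L : Type*} [Ring B] [Algebra k B] [Ring L] [Algebra k L]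
variable {st : BgdST k B L} {cop : L →ₗ[k] st.T2} {cou : L →ₗ[k] B}

/-- Left bisections `σ` together with their automorphism `φ = σ ∘ s` of the base. -/
structure BisectionWith (st : BgdST k B L) (σ : L →ₗ[k] B) (φ : B ≃ₐ[k] B) : Prop where
  unital : σ 1 = 1
  t_prop : ∀ b X, σ (st.t b * X) = σ X * b
  apply_s : ∀ b, σ (st.s b) = φ b
  prod_t : ∀ X Y, σ (X * Y) = σ (X * st.t (σ Y))
  prod_s : ∀ X Y, σ (X * Y) = σ (X * st.s (φ.symm (σ Y)))

theorem IsLeftBisection.exists_bisectionWith {σ : L →ₗ[k] B} (h : st.IsLeftBisection σ) :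
    ∃ φ : B ≃ₐ[k] B, BisectionWith st σ φ := by
  let φ₀ : B →ₐ[k] B := AlgHom.ofLinearMap (σ ∘ₗ st.s.toLinearMap) (by simp [h.unital])
    (fun a b => h.s_mul a b)
  let φ : B ≃ₐ[k] B := AlgEquiv.ofBijective φ₀ h.s_bij
  have hφ : ∀ b, φ b = σ (st.s b) := fun b => rfl
  refine ⟨φ, h.unital, h.t_prop, fun b => rfl, h.prod_t, fun X Y => ?_⟩
  have : φ.symm (σ Y) = Function.invFun (fun b => σ (st.s b)) (σ Y) := by
    apply φ.injective
    rw [AlgEquiv.apply_symm_apply]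
    exact (Function.rightInverse_invFun h.s_bij.surjective (σ Y)).symm
  rw [this]
  exact h.prod_s X Y

theorem leftTr_bal {σ : L →ₗ[k] B} (hσ : ∀ b X, σ (st.t b * X) = σ X * b) :
    st.Bal (fun x y => st.s (σ x) * y) where
  add_left x x' y := by simp [add_mul]
  add_right x y y' := by simp [mul_add]
  smul_left c x y := by simp
  smul_right c x y := by simp
  bal a x y := by simp [hσ, mul_assoc]

namespace BisectionWith

variable {σ : L →ₗ[k] B} {φ : B ≃ₐ[k] B} (h : BisectionWith st σ φ)

include h

theorem apply_s_mul (b : B) (X : L) : σ (st.s b * X) = φ b * σ X := by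
  rw [h.prod_t, st.st_comm, h.t_prop, h.apply_s]

theorem left_bal : st.Bal (fun x y => st.s (σ x) * y) := leftTr_bal h.t_prop

theorem right_bal : st.Bal (fun x y => st.t (φ.symm (σ y)) * x) where
  add_left x x' y := by simp [mul_add]
  add_right x y y' := by simp [add_mul]
  smul_left c x y := by simp
  smul_right c x y := by simp
  bal a x y := by simp [h.apply_s_mul, st.t_mul, mul_assoc]

end BisectionWith

/-- The left translation `X ↦ s(σ(X₍₁₎)) X₍₂₎`. -/
noncomputable def leftTr (cop : L →ₗ[k] st.T2) (σ : L →ₗ[k] B) : L →ₗ[k] L :=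
  st.lift2 (fun x y => st.s (σ x) * y) ∘ₗ cop

/-- The right translation `X ↦ t(φ⁻¹(σ(X₍₂₎))) X₍₁₎`. -/
noncomputable def rightTr (cop : L →ₗ[k] st.T2) (σ : L →ₗ[k] B) (φ : B ≃ₐ[k] B) : L →ₗ[k] L :=
  st.lift2 (fun x y => st.t (φ.symm (σ y)) * x) ∘ₗ cop

/-- The map `X ↦ X₊ t(σ(X₋))`. -/
noncomputable def rightInv (cop : L →ₗ[k] st.T2) (σ : L →ₗ[k] B) (X : L) : L :=
  st.liftOp (fun p m => p * st.t (σ m)) (st.plusMinus cop X)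

section

variable (hL : st.IsLeftBialgebroid cop cou) {σ : L →ₗ[k] B}
  (hσ : ∀ b X, σ (st.t b * X) = σ X * b)

include hL hσ

theorem leftTr_t_mul (b : B) (X : L) : leftTr cop σ (st.t b * X) = st.t b * leftTr cop σ X := by
  simp only [leftTr, LinearMap.comp_apply, hL.comul_t, lift2_lift2 (mk2_t_mul_bal b),
    lift2_mk2 (leftTr_bal hσ)]
  rw [← LinearMap.mulLeft_apply (R := k) (st.t b) (st.lift2 _ _), map_lift2 (leftTr_bal hσ)]
  simp only [LinearMap.mulLeft_apply, ← mul_assoc, st.st_comm]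

theorem leftTr_map_bal : st.Bal (fun x y => st.mk2 (leftTr cop σ x) y) where
  add_left x x' y := by simp [mk2_bal.add_left]
  add_right x y y' := by simp [mk2_bal.add_right]
  smul_left c x y := by simp [mk2_bal.smul_left]
  smul_right c x y := by simp [mk2_bal.smul_right]
  bal a x y := by rw [leftTr_t_mul hL hσ, mk2_bal.bal]

theorem comul_leftTr (X : L) :
    cop (leftTr cop σ X) = st.lift2 (fun x y => st.mk2 (leftTr cop σ x) y) (cop X) := by
  have h3 : Bal3 st (fun x y z => st.mk2 (st.s (σ x) * y) z) := by
    constructor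
    all_goals intros
    all_goals first
      | simp [mk2_bal.add_left, mk2_bal.add_right, mk2_bal.smul_left, mk2_bal.smul_right,
          add_mul, mul_add]
      | simp [hσ, mul_assoc]
      | rw [← mul_assoc, st.st_comm, mul_assoc, mk2_bal.bal]
  have e := hL.coassoc_lift h3 X
  simp only [leftTr, LinearMap.comp_apply]
  rw [map_lift2 (leftTr_bal hσ)]
  simp only [hL.comul_s]
  rw [e]
  congr 2
  funext x z
  let F : L →ₗ[k] st.T2 :=
    { toFun := fun x => st.mk2 x z
      map_add' := fun x y => mk2_bal.add_left x y z
      map_smul' := fun c x => mk2_bal.smul_left c x z }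
  exact (map_lift2 (leftTr_bal hσ) F _).symm

end

namespace BisectionWith

variable {σ : L →ₗ[k] B} {φ : B ≃ₐ[k] B} (h : BisectionWith st σ φ)
  (hL : st.IsLeftBialgebroid cop cou)

include h hL

theorem leftTr_s_mul (b : B) (X : L) :
    leftTr cop σ (st.s b * X) = st.s (φ b) * leftTr cop σ X := by
  simp only [leftTr, LinearMap.comp_apply, hL.comul_s, lift2_lift2 (mk2_s_mul_bal b),
    lift2_mk2 h.left_bal]
  rw [← LinearMap.mulLeft_apply (R := k) (st.s (φ b)) (st.lift2 _ _), map_lift2 h.left_bal]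
  simp only [LinearMap.mulLeft_apply, ← mul_assoc, h.apply_s_mul, map_mul]

theorem rightTr_s_mul (b : B) (X : L) :
    rightTr cop σ φ (st.s b * X) = st.s b * rightTr cop σ φ X := by
  simp only [rightTr, LinearMap.comp_apply, hL.comul_s, lift2_lift2 (mk2_s_mul_bal b),
    lift2_mk2 h.right_bal]
  rw [← LinearMap.mulLeft_apply (R := k) (st.s b) (st.lift2 _ _), map_lift2 h.right_bal]
  simp only [LinearMap.mulLeft_apply, ← mul_assoc, st.st_comm]

theorem rightTr_t_mul (b : B) (X : L) :
    rightTr cop σ φ (st.t b * X) = st.t (φ.symm b) * rightTr cop σ φ X := by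
  simp only [rightTr, LinearMap.comp_apply, hL.comul_t, lift2_lift2 (mk2_t_mul_bal b),
    lift2_mk2 h.right_bal]
  rw [← LinearMap.mulLeft_apply (R := k) (st.t (φ.symm b)) (st.lift2 _ _), map_lift2 h.right_bal]
  simp only [LinearMap.mulLeft_apply, ← mul_assoc, h.t_prop, map_mul, st.t_mul]

theorem leftTr_one : leftTr cop σ 1 = 1 := by
  simp [leftTr, hL.comul_one, lift2_mk2 h.left_bal, h.unital]

theorem rightTr_one : rightTr cop σ φ 1 = 1 := by
  simp [rightTr, hL.comul_one, lift2_mk2 h.right_bal, h.unital, st.t_one]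

theorem leftTr_s (b : B) : leftTr cop σ (st.s b) = st.s (φ b) := by
  simpa [h.leftTr_one hL] using h.leftTr_s_mul hL b 1

theorem leftTr_t (b : B) : leftTr cop σ (st.t b) = st.t b := by
  simpa [h.leftTr_one hL] using leftTr_t_mul hL h.t_prop b 1

theorem leftTr_mul (X Y : L) : leftTr cop σ (X * Y) = leftTr cop σ X * leftTr cop σ Y := by
  refine hL.lift2_cop_mul h.left_bal (fun X y₁ y₂ => ?_) (fun y₁ y₂ => ?_) X Y
  · have hb : st.Bal (fun x₁ x₂ => st.s (σ x₁) * x₂ * y₂) :=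
      h.left_bal.comp (LinearMap.mulRight k y₂)
    have e := hL.takeuchi_lift hb (σ y₁) X
    simp only [← h.prod_t] at e
    rw [← LinearMap.mulRight_apply (R := k) (st.s (σ y₁) * y₂) (st.lift2 _ _),
      map_lift2 h.left_bal]
    simpa only [LinearMap.mulRight_apply, ← mul_assoc] using e
  · constructor
    constructor
    all_goals intros; simp [add_mul, mul_add, mul_assoc, h.t_prop]

theorem rightTr_mul (X Y : L) :
    rightTr cop σ φ (X * Y) = rightTr cop σ φ X * rightTr cop σ φ Y := by
  refine hL.lift2_cop_mul h.right_bal (fun X y₁ y₂ => ?_) (fun y₁ y₂ => ?_) X Y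
  · have hb : st.Bal (fun x₁ x₂ => st.t (φ.symm (σ x₂)) * x₁ * y₁) :=
      h.right_bal.comp (LinearMap.mulRight k y₁)
    have e := (hL.takeuchi_lift hb (φ.symm (σ y₂)) X).symm
    simp only [← h.prod_s] at e
    rw [← LinearMap.mulRight_apply (R := k) (st.t (φ.symm (σ y₂)) * y₁) (st.lift2 _ _),
      map_lift2 h.right_bal]
    simpa only [LinearMap.mulRight_apply, ← mul_assoc] using e
  · constructor
    constructor
    all_goals intros; simp [add_mul, mul_add, mul_assoc, h.apply_s_mul, st.t_mul]

theorem map_rightTr_bal : st.Bal (fun x y => st.mk2 x (rightTr cop σ φ y)) where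
  add_left x x' y := by simp [mk2_bal.add_left]
  add_right x y y' := by simp [mk2_bal.add_right]
  smul_left c x y := by simp [mk2_bal.smul_left]
  smul_right c x y := by simp [mk2_bal.smul_right]
  bal a x y := by rw [h.rightTr_s_mul hL, mk2_bal.bal]

theorem comul_rightTr (X : L) :
    cop (rightTr cop σ φ X) = st.lift2 (fun x y => st.mk2 x (rightTr cop σ φ y)) (cop X) := by
  have h3 : Bal3 st (fun x y z => st.mk2 x (st.t (φ.symm (σ z)) * y)) := by
    constructor
    all_goals intros
    all_goals first
      | simp [mk2_bal.add_left, mk2_bal.add_right, mk2_bal.smul_left, mk2_bal.smul_right,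
          add_mul, mul_add]
      | simp [h.apply_s_mul, st.t_mul, mul_assoc]
      | rw [mk2_bal.bal, ← mul_assoc, st.st_comm, mul_assoc]
  have e := hL.coassoc_lift h3 X
  simp only [rightTr, LinearMap.comp_apply]
  rw [map_lift2 h.right_bal]
  simp only [hL.comul_t]
  rw [← e]
  congr 2
  funext x y
  let F : L →ₗ[k] st.T2 :=
    { toFun := fun y => st.mk2 x y
      map_add' := fun y y' => mk2_bal.add_right x y y'
      map_smul' := fun c y => mk2_bal.smul_right c x y }
  exact (map_lift2 h.right_bal F _).symm

theorem counit_leftTr (X : L) : cou (leftTr cop σ X) = σ X := by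
  conv_rhs => rw [← hL.counit_comul_right X]
  have hb : st.Bal (fun x y => st.t (cou y) * x) := by
    constructor
    constructor
    all_goals intros; simp [add_mul, mul_add, mul_assoc, hL.counit_s, st.t_mul]
  rw [map_lift2 hb, leftTr, LinearMap.comp_apply, map_lift2 h.left_bal]
  simp only [hL.counit_s, h.t_prop]

theorem counit_rightTr (X : L) : cou (rightTr cop σ φ X) = φ.symm (σ X) := by
  conv_rhs => rw [← hL.counit_comul_left X]
  have hb : st.Bal (fun x y => st.s (cou x) * y) := by
    constructor
    constructor
    all_goals intros; simp [add_mul, mul_add, mul_assoc, hL.counit_t]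
  rw [map_lift2 hb, rightTr, LinearMap.comp_apply, map_lift2 h.right_bal]
  have := map_lift2 (R := B) (h.right_bal.comp cou) φ.toLinearMap (cop X)
  apply φ.injective
  refine this.trans ?_
  simp [hL.counit_t, h.apply_s_mul]

variable (hHopf : st.IsLeftHopf cop)

include hHopf

omit h hL in
theorem lam_plusMinus (X : L) : st.lam cop (st.plusMinus cop X) = st.mk2 X 1 :=
  Function.rightInverse_invFun hHopf.surjective _

omit hL hHopf h in
theorem rightInv_bal (σ : L →ₗ[k] B) (hσ : ∀ b X, σ (st.t b * X) = σ X * b) :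
    st.BalOp (fun p m => p * st.t (σ m)) where
  add_left x x' y := by simp [add_mul]
  add_right x y y' := by simp [mul_add]
  smul_left c x y := by simp
  smul_right c x y := by simp
  bal a x y := by simp [hσ, st.t_mul, mul_assoc]

theorem rightTr_rightInv (X : L) : rightTr cop σ φ (rightInv cop σ X) = X := by
  have e : rightTr cop σ φ ∘ₗ st.liftOp (fun p m => p * st.t (σ m)) =
      st.lift2 (fun x y => st.t (φ.symm (σ y)) * x) ∘ₗ st.lam cop := by
    refine extOp fun p m => ?_
    simp only [LinearMap.comp_apply, liftOp_mkOp (rightInv_bal σ h.t_prop), hL.lam_mkOp_s1,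
      lift2_lift2 (mk2_mul_bal _), lift2_mk2 h.right_bal, rightTr, hL.comul_mul_t, ← h.prod_t]
  have e' := LinearMap.congr_fun e (st.plusMinus cop X)
  simp only [LinearMap.comp_apply, lam_plusMinus hHopf, lift2_mk2 h.right_bal, h.unital, map_one,
    st.t_one, one_mul] at e'
  exact e'

theorem rightInv_rightTr (X : L) : rightInv cop σ (rightTr cop σ φ X) = X := by
  let lamE : st.TOp ≃ₗ[k] st.T2 := LinearEquiv.ofBijective (st.lam cop) hHopf
  let G : st.TOp →ₗ[k] L := st.liftOp (fun p m => p * st.t (σ m))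
  let D : st.T2 →ₗ[k] L := G ∘ₗ lamE.symm.toLinearMap
  have hD : ∀ z, D (st.lam cop z) = G z := fun z => congrArg G (lamE.symm_apply_apply z)
  have hC : ∀ x, rightInv cop σ x = D (st.mk2 x 1) := fun x => by
    rw [← lam_plusMinus hHopf, hD]; rfl
  have hG : ∀ x y, G (st.mkOp x y) = x * st.t (σ y) :=
    liftOp_mkOp (rightInv_bal σ h.t_prop)
  have hmk : ∀ x y, D (st.mk2 x y) = G (st.liftOp (fun p q => st.mkOp p (q * y))
      (st.plusMinus cop x)) := fun x y => by
    rw [← hD, hL.lam_mul, lam_plusMinus hHopf, lift2_mk2 (mk2_mul_bal y), one_mul]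
  have hGs : ∀ y z, G (st.liftOp (fun p q => st.mkOp p (q * y)) z) =
      G (st.liftOp (fun p q => st.mkOp p (q * st.s (φ.symm (σ y)))) z) := fun y z => by
    refine LinearMap.congr_fun (f := G ∘ₗ st.liftOp _) (g := G ∘ₗ st.liftOp _)
      (extOp fun p q => ?_) z
    simp only [LinearMap.comp_apply, liftOp_mkOp (mkOp_mul_bal _), hG, ← h.prod_s]
  let F : L →ₗ[k] L :=
    { toFun := fun x => D (st.mk2 x 1)
      map_add' := fun x y => by simp [mk2_bal.add_left]
      map_smul' := fun c x => by simp [mk2_bal.smul_left] }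
  have hF : ∀ x y, F (st.t (φ.symm (σ y)) * x) = D (st.mk2 x y) := fun x y => by
    change D (st.mk2 _ 1) = _
    rw [mk2_bal.bal, mul_one, hmk x y, hGs, ← hmk]
  rw [hC]
  change F (rightTr cop σ φ X) = X
  rw [rightTr, LinearMap.comp_apply, map_lift2 h.right_bal]
  simp only [hF]
  rw [← map_lift2 mk2_bal, lift2_mk_s1]
  have := hL.lam_mkOp_s1 X 1
  simp only [mul_one] at this
  rw [lift2_mk_s1] at this
  rw [← this, hD, hG, h.unital, st.t_one, mul_one]

theorem rightTr_bijective : Function.Bijective (rightTr cop σ φ) :=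
  ⟨Function.LeftInverse.injective (h.rightInv_rightTr hL hHopf),
    Function.RightInverse.surjective (h.rightTr_rightInv hL hHopf)⟩

end BisectionWith

end Bisection

end BgdST

namespace BgdST

section Adjoint

variable {k : Type*} [Field k] {B L : Type*} [Ring B] [Algebra k B] [Ring L] [Algebra k L]
variable {st : BgdST k B L} {cop : L →ₗ[k] st.T2} {cou : L →ₗ[k] B}

namespace BisectionWith

variable {σ : L →ₗ[k] B} {φ : B ≃ₐ[k] B} (h : BisectionWith st σ φ)
  (hL : st.IsLeftBialgebroid cop cou)

include h hL

/-- Left and right translations commute. -/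
theorem rightTr_leftTr {η : L →ₗ[k] B} (hη : ∀ b X, η (st.t b * X) = η X * b) (X : L) :
    rightTr cop σ φ (leftTr cop η X) = leftTr cop η (rightTr cop σ φ X) := by
  conv_rhs => rw [leftTr, LinearMap.comp_apply, h.comul_rightTr hL,
    lift2_lift2 (h.map_rightTr_bal hL)]
  conv_lhs => rw [leftTr, LinearMap.comp_apply, map_lift2 (leftTr_bal hη)]
  simp only [h.rightTr_s_mul hL, lift2_mk2 (leftTr_bal hη)]

omit hL in
theorem apply_leftTr {η : L →ₗ[k] B} {ψ : B ≃ₐ[k] B} (hη : BisectionWith st η ψ) (X : L) :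
    σ (leftTr cop η X) = φ (η (rightTr cop σ φ X)) := by
  rw [leftTr, LinearMap.comp_apply, map_lift2 hη.left_bal, rightTr, LinearMap.comp_apply,
    map_lift2 h.right_bal]
  refine Eq.trans ?_ (map_lift2 (h.right_bal.comp η) φ.toLinearMap (cop X)).symm
  simp [h.apply_s_mul, hη.t_prop]

omit h hL in
theorem bconv_eq {η : L →ₗ[k] B} (hη : ∀ b X, η (st.t b * X) = η X * b) :
    st.bconv cop σ η = σ ∘ₗ leftTr cop η := by
  ext X
  exact (map_lift2 (leftTr_bal hη) σ (cop X)).symm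

theorem leftTr_leftTr {η : L →ₗ[k] B} (hη : ∀ b X, η (st.t b * X) = η X * b) (X : L) :
    leftTr cop σ (leftTr cop η X) = leftTr cop (st.bconv cop σ η) X := by
  rw [bconv_eq hη]
  conv_lhs => rw [leftTr, LinearMap.comp_apply, comul_leftTr hL hη,
    lift2_lift2 (leftTr_map_bal hL hη)]
  simp only [lift2_mk2 h.left_bal]
  rfl

theorem bconv {η : L →ₗ[k] B} {ψ : B ≃ₐ[k] B} (hη : BisectionWith st η ψ) :
    BisectionWith st (st.bconv cop σ η) (ψ.trans φ) := by
  rw [bconv_eq hη.t_prop]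
  constructor
  · simp [hη.leftTr_one hL, h.unital]
  · simp [leftTr_t_mul hL hη.t_prop, h.t_prop]
  · simp [hη.leftTr_s hL, h.apply_s]
  · intro X Y
    simp only [LinearMap.comp_apply, hη.leftTr_mul hL, hη.leftTr_t hL]
    exact h.prod_t _ _
  · intro X Y
    simp only [LinearMap.comp_apply, hη.leftTr_mul hL, hη.leftTr_s hL]
    simpa using h.prod_s _ _

theorem rightTr_rightTr {η : L →ₗ[k] B} {ψ : B ≃ₐ[k] B} (hη : BisectionWith st η ψ) (X : L) :
    rightTr cop η ψ (rightTr cop σ φ X) = rightTr cop (st.bconv cop σ η) (ψ.trans φ) X := by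
  conv_lhs => rw [rightTr, LinearMap.comp_apply, h.comul_rightTr hL,
    lift2_lift2 (h.map_rightTr_bal hL)]
  simp only [lift2_mk2 hη.right_bal]
  have e : ∀ y, (ψ.trans φ).symm (st.bconv cop σ η y) = ψ.symm (η (rightTr cop σ φ y)) :=
    fun y => by simp [bconv_eq hη.t_prop, h.apply_leftTr hη]
  conv_rhs => rw [rightTr, LinearMap.comp_apply]
  simp only [e]

variable (hHopf : st.IsLeftHopf cop)

/-- `rightInv` as a linear map. -/
noncomputable def rightInvLin : L →ₗ[k] L where
  toFun := rightInv cop σ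
  map_add' X Y := (h.rightTr_bijective hL hHopf).injective <| by
    simp [h.rightTr_rightInv hL hHopf]
  map_smul' c X := (h.rightTr_bijective hL hHopf).injective <| by
    simp [h.rightTr_rightInv hL hHopf]

theorem rightTr_lin (X : L) : rightTr cop σ φ (h.rightInvLin hL hHopf X) = X :=
  h.rightTr_rightInv hL hHopf X

theorem lin_rightTr (X : L) : h.rightInvLin hL hHopf (rightTr cop σ φ X) = X :=
  h.rightInv_rightTr hL hHopf X

theorem lin_injective : Function.Injective (h.rightInvLin hL hHopf) :=
  Function.LeftInverse.injective (h.rightTr_lin hL hHopf)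

theorem lin_surjective : Function.Surjective (h.rightInvLin hL hHopf) :=
  Function.RightInverse.surjective (h.lin_rightTr hL hHopf)

theorem lin_mul (X Y : L) : h.rightInvLin hL hHopf (X * Y) =
    h.rightInvLin hL hHopf X * h.rightInvLin hL hHopf Y :=
  (h.rightTr_bijective hL hHopf).injective <| by
    rw [h.rightTr_mul hL]; simp only [h.rightTr_lin hL]

theorem lin_one : h.rightInvLin hL hHopf 1 = 1 :=
  (h.rightTr_bijective hL hHopf).injective <| by
    rw [h.rightTr_lin hL, h.rightTr_one hL]

theorem lin_s_mul (b : B) (X : L) : h.rightInvLin hL hHopf (st.s b * X) =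
    st.s b * h.rightInvLin hL hHopf X :=
  (h.rightTr_bijective hL hHopf).injective <| by
    rw [h.rightTr_s_mul hL]; simp only [h.rightTr_lin hL]

theorem lin_t_mul (b : B) (X : L) : h.rightInvLin hL hHopf (st.t b * X) =
    st.t (φ b) * h.rightInvLin hL hHopf X :=
  (h.rightTr_bijective hL hHopf).injective <| by
    rw [h.rightTr_t_mul hL]; simp only [h.rightTr_lin hL, AlgEquiv.symm_apply_apply]

theorem lin_s (b : B) : h.rightInvLin hL hHopf (st.s b) = st.s b := by
  simpa [h.lin_one hL] using h.lin_s_mul hL hHopf b 1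

theorem lin_t (b : B) : h.rightInvLin hL hHopf (st.t b) = st.t (φ b) := by
  simpa [h.lin_one hL] using h.lin_t_mul hL hHopf b 1

theorem lin_leftTr {η : L →ₗ[k] B} (hη : ∀ b X, η (st.t b * X) = η X * b) (X : L) :
    h.rightInvLin hL hHopf (leftTr cop η X) = leftTr cop η (h.rightInvLin hL hHopf X) :=
  (h.rightTr_bijective hL hHopf).injective <| by
    rw [h.rightTr_leftTr hL hη]; simp only [h.rightTr_lin hL]

theorem map_lin_bal : st.Bal (fun x y => st.mk2 x (h.rightInvLin hL hHopf y)) :=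
  mk2_map_bal (f := LinearMap.id) id (fun _ _ => rfl) (h.lin_s_mul hL hHopf)

theorem comul_lin (X : L) : cop (h.rightInvLin hL hHopf X) =
    st.lift2 (fun x y => st.mk2 x (h.rightInvLin hL hHopf y)) (cop X) := by
  obtain ⟨Y, rfl⟩ := (h.rightTr_bijective hL hHopf).surjective X
  rw [h.lin_rightTr hL, h.comul_rightTr hL, lift2_lift2 (h.map_rightTr_bal hL)]
  simp only [lift2_mk2 (h.map_lin_bal hL hHopf), h.lin_rightTr hL]
  exact (lift2_mk_s1 _).symm

/-- The adjoint action is the composite of a left and an inverse right translation. -/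
theorem adL_eq (X : L) : st.adL cop σ X = leftTr cop σ (h.rightInvLin hL hHopf X) := by
  rw [leftTr, LinearMap.comp_apply, h.comul_lin hL, lift2_lift2 (h.map_lin_bal hL hHopf)]
  simp only [lift2_mk2 h.left_bal]
  rfl

theorem t_mul_lin (x y : L) : st.t (σ y) * h.rightInvLin hL hHopf x =
    h.rightInvLin hL hHopf (st.t (φ.symm (σ y)) * x) := by
  rw [h.lin_t_mul hL, AlgEquiv.apply_symm_apply]

theorem counit_leftTr_lin (X : L) :
    cou (leftTr cop σ (h.rightInvLin hL hHopf X)) = φ (cou X) := by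
  obtain ⟨Y, rfl⟩ := (h.rightTr_bijective hL hHopf).surjective X
  rw [h.lin_rightTr hL, h.counit_leftTr hL, h.counit_rightTr hL, AlgEquiv.apply_symm_apply]

theorem lin_leftTr_map_bal :
    st.Bal (fun x y => st.mk2 (h.rightInvLin hL hHopf x) (leftTr cop σ y)) :=
  mk2_map_bal φ (h.lin_t_mul hL hHopf) (h.leftTr_s_mul hL)

theorem leftTr_lin_map_bal :
    st.Bal (fun x y => st.mk2 (leftTr cop σ x) (h.rightInvLin hL hHopf y)) :=
  mk2_map_bal id (leftTr_t_mul hL h.t_prop) (h.lin_s_mul hL hHopf)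

theorem lift2_lin_leftTr (X : L) :
    st.lift2 (fun x y => st.mk2 (h.rightInvLin hL hHopf x) (leftTr cop σ y)) (cop X) = cop X := by
  have h3 : Bal3 st (fun x y z => st.mk2 (h.rightInvLin hL hHopf (st.t (φ.symm (σ y)) * x)) z) := by
    simp only [← h.t_mul_lin hL]
    constructor
    all_goals intros
    all_goals first
      | simp [mk2_bal.add_left, mk2_bal.add_right, mk2_bal.smul_left, mk2_bal.smul_right,
          add_mul, mul_add]
      | simp [h.apply_s_mul, h.lin_t_mul hL, st.t_mul, mul_assoc]
      | rw [h.t_prop, st.t_mul, mul_assoc, mk2_bal.bal]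
  have e := hL.coassoc_lift h3 X
  have e₁ : ∀ x y, st.lift2 (fun y z => st.mk2 (h.rightInvLin hL hHopf
      (st.t (φ.symm (σ y)) * x)) z) (cop y) =
      st.mk2 (h.rightInvLin hL hHopf x) (leftTr cop σ y) := fun x y => by
    simp only [← h.t_mul_lin hL, mk2_bal.bal]
    let F : L →ₗ[k] st.T2 :=
      { toFun := fun y => st.mk2 (h.rightInvLin hL hHopf x) y
        map_add' := fun y y' => mk2_bal.add_right _ y y'
        map_smul' := fun c y => mk2_bal.smul_right c _ y }
    exact (map_lift2 h.left_bal F _).symm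
  have e₂ : ∀ x z, st.lift2 (fun x₁ x₂ => st.mk2 (h.rightInvLin hL hHopf
      (st.t (φ.symm (σ x₂)) * x₁)) z) (cop x) = st.mk2 x z := fun x z => by
    let F : L →ₗ[k] st.T2 :=
      { toFun := fun x => st.mk2 (h.rightInvLin hL hHopf x) z
        map_add' := fun x y => by simp [mk2_bal.add_left]
        map_smul' := fun c x => by simp [mk2_bal.smul_left] }
    refine (map_lift2 h.right_bal F _).symm.trans ?_
    exact congrArg (fun w => st.mk2 w z) (h.lin_rightTr hL hHopf x)
  simp only [e₁, e₂] at e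
  rw [e]
  exact lift2_mk_s1 _

theorem comul_leftTr_lin (X : L) : cop (leftTr cop σ (h.rightInvLin hL hHopf X)) =
    st.lift2 (fun x y => st.mk2 (leftTr cop σ (h.rightInvLin hL hHopf x))
      (leftTr cop σ (h.rightInvLin hL hHopf y))) (cop X) := by
  rw [comul_leftTr hL h.t_prop, h.comul_lin hL, lift2_lift2 (h.map_lin_bal hL hHopf)]
  simp only [lift2_mk2 (leftTr_map_bal hL h.t_prop)]
  conv_lhs => rw [← h.lift2_lin_leftTr hL hHopf X]
  rw [lift2_lift2 (h.lin_leftTr_map_bal hL hHopf)]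
  simp only [lift2_mk2 (h.leftTr_lin_map_bal hL hHopf), h.lin_leftTr hL hHopf h.t_prop]

include hHopf in
theorem leftTr_bijective : Function.Bijective (leftTr cop σ) := by
  let τ : L →ₗ[k] B := φ.symm.toLinearMap ∘ₗ cou ∘ₗ h.rightInvLin hL hHopf
  have hτ : ∀ x, τ x = φ.symm (cou (h.rightInvLin hL hHopf x)) := fun x => rfl
  have hτt : ∀ b X, τ (st.t b * X) = τ X * b := fun b X => by
    simp [hτ, h.lin_t_mul hL, hL.counit_t]
  constructor
  · refine Function.LeftInverse.injective (g := leftTr cop τ) fun X => ?_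
    rw [leftTr, LinearMap.comp_apply, comul_leftTr hL h.t_prop,
      lift2_lift2 (leftTr_map_bal hL h.t_prop)]
    simp only [lift2_mk2 (leftTr_bal hτt)]
    simp only [hτ, h.lin_leftTr hL hHopf h.t_prop,
      h.counit_leftTr_lin hL, AlgEquiv.symm_apply_apply]
    exact hL.counit_comul_left X
  · refine Function.RightInverse.surjective (g := leftTr cop τ) fun X => ?_
    have e : ∀ Y, σ (leftTr cop τ Y) = cou Y := fun Y => by
      conv_rhs => rw [← h.lin_rightTr hL hHopf Y]
      rw [leftTr, LinearMap.comp_apply, map_lift2 (leftTr_bal hτt), rightTr,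
        LinearMap.comp_apply, map_lift2 h.right_bal,
        map_lift2 (h.right_bal.comp (h.rightInvLin hL hHopf))]
      simp [h.apply_s_mul, hτ, h.lin_t_mul hL, hL.counit_t]
    rw [leftTr, LinearMap.comp_apply, comul_leftTr hL hτt,
      lift2_lift2 (leftTr_map_bal hL hτt)]
    simp only [lift2_mk2 h.left_bal, e]
    exact hL.counit_comul_left X

theorem lin_lin {η : L →ₗ[k] B} {ψ : B ≃ₐ[k] B} (hη : BisectionWith st η ψ) (X : L) :
    h.rightInvLin hL hHopf (hη.rightInvLin hL hHopf X) =
      (h.bconv hL hη).rightInvLin hL hHopf X := by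
  apply ((h.bconv hL hη).rightTr_bijective hL hHopf).injective
  rw [rightTr_lin, ← h.rightTr_rightTr hL hη, rightTr_lin, rightTr_lin]

include hHopf in
theorem adL_adL {η : L →ₗ[k] B} {ψ : B ≃ₐ[k] B} (hη : BisectionWith st η ψ) (X : L) :
    st.adL cop σ (st.adL cop η X) = st.adL cop (st.bconv cop σ η) X := by
  rw [h.adL_eq hL hHopf, hη.adL_eq hL hHopf, (h.bconv hL hη).adL_eq hL hHopf,
    h.lin_leftTr hL hHopf hη.t_prop, h.lin_lin hL hHopf hη, h.leftTr_leftTr hL hη.t_prop]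

/-- The adjoint action as an algebra map. -/
noncomputable def adAlgHom : L →ₐ[k] L :=
  AlgHom.ofLinearMap (leftTr cop σ ∘ₗ h.rightInvLin hL hHopf)
    (by simp [h.lin_one hL, h.leftTr_one hL])
    (fun X Y => by simp [h.lin_mul hL, h.leftTr_mul hL])

theorem adAlgHom_isBgdAut : st.IsBgdAut cop cou (h.adAlgHom hL hHopf) φ.toAlgHom where
  bijL := (h.leftTr_bijective hL hHopf).comp
    ⟨h.lin_injective hL hHopf, h.lin_surjective hL hHopf⟩
  bijB := φ.bijective
  comp_s b := by simp [adAlgHom, h.lin_s hL, h.leftTr_s hL]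
  comp_t b := by simp [adAlgHom, h.lin_t hL, h.leftTr_t hL]
  comp_comul := h.comul_leftTr_lin hL hHopf
  comp_counit := h.counit_leftTr_lin hL hHopf

end BisectionWith

end Adjoint

end BgdST

/-- For every left bisection `σ` of a left Hopf algebroid `L` over `B`, the pair
`(Ad^L_σ, ad^L_σ)` with `Ad^L_σ(X) = s(σ(X₍₁₎)) X₍₂₎₊ t(σ(X₍₂₎₋))` and `ad^L_σ = σ∘s` is an
automorphism of the left bialgebroid `L`; moreover `Ad^L_σ ∘ Ad^L_η = Ad^L_{σ*η}` for left
bisections `σ, η`, where `(σ*η)(X) = σ(s(η(X₍₁₎)) X₍₂₎)`. -/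
theorem adL_is_automorphism
    {k : Type*} [Field k] {B L : Type*} [Ring B] [Algebra k B] [Ring L] [Algebra k L]
    (st : BgdST k B L) (cop : L →ₗ[k] st.T2) (cou : L →ₗ[k] B)
    (hbgd : st.IsLeftBialgebroid cop cou) (hHopf : st.IsLeftHopf cop) :
    (∀ σ : L →ₗ[k] B, st.IsLeftBisection σ →
      ∃ (Φ : L →ₐ[k] L) (φ : B →ₐ[k] B),
        (∀ X : L, Φ X = st.adL cop σ X) ∧ (∀ b : B, φ b = σ (st.s b)) ∧
        st.IsBgdAut cop cou Φ φ) ∧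
    (∀ σ η : L →ₗ[k] B, st.IsLeftBisection σ → st.IsLeftBisection η →
      ∀ X : L, st.adL cop σ (st.adL cop η X) = st.adL cop (st.bconv cop σ η) X) := by
  refine ⟨fun σ hσ => ?_, fun σ η hσ hη X => ?_⟩
  · obtain ⟨φ, h⟩ := hσ.exists_bisectionWith
    exact ⟨h.adAlgHom hbgd hHopf, φ.toAlgHom, fun X => (h.adL_eq hbgd hHopf X).symm,
      fun b => (h.apply_s b).symm, h.adAlgHom_isBgdAut hbgd hHopf⟩
  · obtain ⟨φ, h⟩ := hσ.exists_bisectionWith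
    obtain ⟨ψ, h'⟩ := hη.exists_bisectionWith
    exact h.adL_adL hbgd hHopf h' X
end
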